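/- arXiv:math/0005273 — 13 statements merged into one kernel-verified Lean document; each statement's English description precedes it below -/
import Mathlib

section
/- On any infinite set X there are exactly 2^(2^|X|) many precomplete clones on X. -/
open Cardinal Set

universe u v

abbrev Operation (X : Type u) : Type u := Σ n : ℕ, ((Fin (n + 1) → X) → X)

def IsClone {X : Type u} (C : Set (Operation X)) : Prop :=
  (∀ (n : ℕ) (k : Fin (n + 1)), (⟨n, fun x => x k⟩ : Operation X) ∈ C) ∧
  (∀ (n m : ℕ) (g : (Fin (m + 1) → X) → X) (f : Fin (m + 1) → (Fin (n + 1) → X) → X),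
    (⟨m, g⟩ : Operation X) ∈ C → (∀ i, (⟨n, f i⟩ : Operation X) ∈ C) →
    (⟨n, fun x => g fun i => f i x⟩ : Operation X) ∈ C)

def unaryOp {X : Type u} (f : X → X) : Operation X := ⟨0, fun x => f (x 0)⟩

def binOp {X : Type u} (g : X → X → X) : Operation X := ⟨1, fun x => g (x 0) (x 1)⟩

def PrecompleteClone {X : Type u} (C : Set (Operation X)) : Prop :=
  IsClone C ∧ C ≠ Set.univ ∧
    ∀ D : Set (Operation X), IsClone D → C ⊆ D → D = C ∨ D = Set.univ

def cloneGen {X : Type u} (F : Set (Operation X)) : Set (Operation X) :=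
  ⋂₀ {C : Set (Operation X) | IsClone C ∧ F ⊆ C}

def cl {X : Type u} (F : Set (Operation X)) : Set (Operation X) :=
  ⋂₀ {C : Set (Operation X) | IsClone C ∧ F ⊆ C ∧ ∀ f : X → X, unaryOp f ∈ C}

def Pol {X : Type u} {I : Type v} (R : Set (I → X)) : Set (Operation X) :=
  {op | ∀ ρ : Fin (op.1 + 1) → (I → X), (∀ j, ρ j ∈ R) →
    (fun i => op.2 fun j => ρ j i) ∈ R}

def IsPairing {X : Type u} (f : X → X → X) : Prop :=
  ∀ ⦃x y x' y' : X⦄, x ≠ y → x' ≠ y' → f x y = f x' y' → x = x' ∧ y = y'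

def almostUnary2 {X : Type u} (g : X × X → X) : Prop :=
  ∃ G : X → Set X, (∀ x : X, #↥(G x) < #X) ∧
    ((∀ p : X × X, g p ∈ G p.1) ∨ (∀ p : X × X, g p ∈ G p.2))

def AU2 (X : Type u) : Set (X × X → X) := {g | almostUnary2 g}

def HeavilyBinary {X : Type u} (C : Set (Operation X)) : Prop :=
  ∃ H : X → X → X, binOp H ∈ C ∧
    (∃ b : X, #↥(Set.range fun x => H x b) = #X) ∧
    (∃ a : X, #↥(Set.range fun y => H a y) = #X)

def IsCanonicalOn {X : Type u} [LinearOrder X] (F : X → X → X) (S : Set X) : Prop :=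
  ∀ a b : Fin 4 → X, (∀ i, a i ∈ S) → (∀ i, b i ∈ S) →
    (∀ i j, a i < a j ↔ b i < b j) → a 0 ≠ a 1 → a 2 ≠ a 3 →
    (F (a 0) (a 1) < F (a 2) (a 3) → F (b 0) (b 1) < F (b 2) (b 3))

def PrColoring {X : Type u} {M : Type v} [LinearOrder X] (c : X → X → M) : Prop :=
  (∀ x y : X, c x y = c y x) ∧
  ∀ a : X → Finset X, (∀ i j : X, i ≠ j → Disjoint (a i) (a j)) →
    ∀ c₀ : M, ∃ i j : X, i < j ∧ ∀ x ∈ a i, ∀ y ∈ a j, c x y = c₀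

open Classical in
noncomputable def FA {X : Type u} {M : Type v} [LinearOrder X]
    (c : X → X → M) (pr : X → X → X) (z : X) (A : Set M) (α β : X) : X :=
  if α = z ∨ β = z ∨ α = β then max α β
  else if c α β ∈ A then pr α β else z

/-- The clone of all operations that map powers of `U`-null sets to `U`-null sets. -/
def ultrafilterClone {X : Type u} (U : Ultrafilter X) : Set (Operation X) :=
  {op | ∀ A : Set X, A ∉ U → op.2 '' {x | ∀ j, x j ∈ A} ∉ U}

theorem Ultrafilter.notMem_of_subset {X : Type u} {U : Ultrafilter X} {A B : Set X}
    (hB : B ∉ U) (h : A ⊆ B) : A ∉ U :=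
  fun hA => hB (Filter.mem_of_superset hA h)

theorem mem_ultrafilterClone_of_subset {X : Type u} {U : Ultrafilter X} {n : ℕ}
    {q : (Fin (n + 1) → X) → X} {B : Set X} (hB : B ∉ U) (h : ∀ x, q x ∈ B) :
    (⟨n, q⟩ : Operation X) ∈ ultrafilterClone U := by
  rintro A -
  refine Ultrafilter.notMem_of_subset hB ?_
  rintro _ ⟨x, -, rfl⟩
  exact h x

theorem isClone_ultrafilterClone {X : Type u} (U : Ultrafilter X) :
    IsClone (ultrafilterClone U) := by
  refine ⟨fun n k A hA => Ultrafilter.notMem_of_subset hA ?_, fun n m g f hg hf A hA => ?_⟩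
  · rintro _ ⟨x, hx, rfl⟩
    exact hx k
  · have hB : (⋃ i ∈ (Set.univ : Set (Fin (m + 1))), f i '' {x | ∀ j, x j ∈ A}) ∉ U := by
      rw [Ultrafilter.finite_biUnion_mem_iff Set.finite_univ]
      rintro ⟨i, -, hi⟩
      exact hf i A hA hi
    refine Ultrafilter.notMem_of_subset (hg _ hB) ?_
    rintro _ ⟨x, hx, rfl⟩
    exact ⟨fun i => f i x, fun i => Set.mem_biUnion (Set.mem_univ i) ⟨x, hx, rfl⟩, rfl⟩

theorem exists_notMem_ultrafilter_image_eq_univ {X : Type u} [Infinite X] (U : Ultrafilter X) :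
    ∃ A ∉ U, ∃ r : X → X, r '' A = Set.univ := by
  obtain ⟨e⟩ : Nonempty (X ≃ X ⊕ X) := by
    rw [← Cardinal.eq, Cardinal.mk_sum, Cardinal.lift_id, Cardinal.add_eq_self (aleph0_le_mk X)]
  have key : e ⁻¹' Set.range Sum.inl ∉ U ∨ e ⁻¹' Set.range Sum.inr ∉ U := by
    by_contra! h
    obtain ⟨x, ⟨y, hy⟩, ⟨z, hz⟩⟩ := U.nonempty_of_mem (Filter.inter_mem h.1 h.2)
    simp [← hz] at hy
  rcases key with h | h
  · exact ⟨_, h, fun x => (e x).elim id id, Set.eq_univ_of_forall fun x =>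
      ⟨e.symm (Sum.inl x), by simp, by simp⟩⟩
  · exact ⟨_, h, fun x => (e x).elim id id, Set.eq_univ_of_forall fun x =>
      ⟨e.symm (Sum.inr x), by simp, by simp⟩⟩

theorem mem_ultrafilter_iff_exists_unaryOp {X : Type u} [Infinite X] (U : Ultrafilter X)
    (B : Set X) : B ∈ U ↔ ∃ f : X → X, (∀ x, f x ∈ B) ∧ unaryOp f ∉ ultrafilterClone U := by
  classical
  constructor
  · intro hB
    obtain ⟨A, hA, r, hr⟩ := exists_notMem_ultrafilter_image_eq_univ U
    obtain ⟨b, hb⟩ := U.nonempty_of_mem hB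
    refine ⟨fun x => if r x ∈ B then r x else b, fun x => ?_, fun h => h A hA ?_⟩
    · dsimp only
      split_ifs with h
      exacts [h, hb]
    · refine Filter.mem_of_superset hB fun y hy => ?_
      obtain ⟨x, hx, rfl⟩ : y ∈ r '' A := hr ▸ Set.mem_univ y
      exact ⟨fun _ => x, fun _ => hx, if_pos hy⟩
  · rintro ⟨f, hf, h⟩
    by_contra hB
    exact h (mem_ultrafilterClone_of_subset hB fun x => hf (x 0))

theorem ultrafilterClone_injective {X : Type u} [Infinite X] :
    Function.Injective (ultrafilterClone : Ultrafilter X → Set (Operation X)) := by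
  intro U V h
  ext B
  rw [mem_ultrafilter_iff_exists_unaryOp U, mem_ultrafilter_iff_exists_unaryOp V, h]

theorem precompleteClone_ultrafilterClone {X : Type u} [Infinite X] {U : Ultrafilter X}
    (hU : ∀ a, {a} ∉ U) : PrecompleteClone (ultrafilterClone U) := by
  classical
  refine ⟨isClone_ultrafilterClone U, ?_, fun D hD hCD => ?_⟩
  · obtain ⟨f, -, hf⟩ := (mem_ultrafilter_iff_exists_unaryOp U Set.univ).1 Filter.univ_mem
    exact fun h => hf (h ▸ Set.mem_univ _)
  rw [or_iff_not_imp_left]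
  intro hne
  obtain ⟨⟨n, g⟩, hgD, hg⟩ := Set.exists_of_ssubset (hCD.ssubset_of_ne (Ne.symm hne))
  obtain ⟨A, hA, hB⟩ : ∃ A : Set X, A ∉ U ∧ g '' {x | ∀ j, x j ∈ A} ∈ U := by
    simpa [ultrafilterClone] using hg
  set B := g '' {x | ∀ j, x j ∈ A}
  have hs : ∀ b ∈ B, ∃ s, (∀ j, s j ∈ A) ∧ g s = b := fun b hb => hb
  choose! s hsA hsB using hs
  have onB : ∀ (m : ℕ) (q : (Fin (m + 1) → X) → X), (∀ x, q x ∈ B) →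
      (⟨m, q⟩ : Operation X) ∈ D := by
    intro m q hq
    have := hD.2 m n g (fun i x => s (q x) i) hgD fun i =>
      hCD (mem_ultrafilterClone_of_subset hA fun x => hsA _ (hq x) i)
    convert this using 3 with x
    exact (hsB _ (hq x)).symm
  obtain ⟨b, hb⟩ := U.nonempty_of_mem hB
  refine Set.eq_univ_of_forall fun ⟨m, q⟩ => ?_
  have hin : (⟨m, fun x => if q x ∈ B then q x else b⟩ : Operation X) ∈ D := by
    refine onB m _ fun x => ?_
    split_ifs with h
    exacts [h, hb]
  have hout : (⟨m, fun x => if q x ∈ B then b else q x⟩ : Operation X) ∈ D := by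
    refine hCD (mem_ultrafilterClone_of_subset (B := {b} ∪ Bᶜ) ?_ fun x => ?_)
    · rw [Ultrafilter.union_mem_iff, Ultrafilter.compl_mem_iff_notMem]
      exact fun h => h.elim (hU b) fun h => h hB
    · split_ifs with h
      exacts [Or.inl rfl, Or.inr h]
  have hsel : (⟨1, fun x => if x 1 = b then x 0 else x 1⟩ : Operation X) ∈ D := by
    refine hCD fun A hA => Ultrafilter.notMem_of_subset hA ?_
    rintro _ ⟨x, hx, rfl⟩
    dsimp only
    split_ifs
    exacts [hx 0, hx 1]
  have := hD.2 m 1 _ ![fun x => if q x ∈ B then q x else b, fun x => if q x ∈ B then b else q x]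
    hsel (by simpa [Fin.forall_fin_two] using ⟨hin, hout⟩)
  convert this using 3 with x
  by_cases h : q x ∈ B
  · simp [h]
  · have : q x ≠ b := fun h' => h (h' ▸ hb)
    simp [h, this]

open Classical in
/-- The independent family of Fichtenholz, Kantorovich and Hausdorff. -/
def independentSet {X : Type u} (T : Set X) : Set (Finset X × Finset (Finset X)) :=
  {p | p.1.filter (· ∈ T) ∈ p.2}

theorem exists_mem_independentSet_iff {X : Type u} (t : Finset (Set X)) (𝒯 : Set (Set X)) :
    ∃ p, ∀ T ∈ t, p ∈ independentSet T ↔ T ∈ 𝒯 := by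
  classical
  have hd : ∀ p : Set X × Set X, ∃ D : Finset X, (∀ x ∈ D, x ∈ p.1 ↔ x ∈ p.2) → p.1 = p.2 := by
    rintro ⟨S, T⟩
    by_cases h : S = T
    · exact ⟨∅, fun _ => h⟩
    · obtain ⟨x, hx⟩ : ∃ x, ¬(x ∈ S ↔ x ∈ T) := by
        by_contra! h'
        exact h (Set.ext h')
      exact ⟨{x}, fun h' => absurd (h' x (Finset.mem_singleton_self x)) hx⟩
  choose d hd using hd
  refine ⟨⟨(t ×ˢ t).biUnion d, (t.filter (· ∈ 𝒯)).image
    fun T => ((t ×ˢ t).biUnion d).filter (· ∈ T)⟩, fun T hT => ⟨fun h => ?_, fun h => ?_⟩⟩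
  · obtain ⟨S, hS, hST⟩ := Finset.mem_image.1 h
    rw [Finset.mem_filter] at hS
    rw [Finset.filter_inj'] at hST
    have hSeq : S = T := hd (S, T) fun x hx =>
      hST (Finset.mem_biUnion.2 ⟨_, Finset.mk_mem_product hS.1 hT, hx⟩)
    exact hSeq ▸ hS.2
  · exact Finset.mem_image.2 ⟨T, Finset.mem_filter.2 ⟨hT, h⟩, rfl⟩

theorem exists_ultrafilter_independentSet_mem_iff {X : Type u} (𝒯 : Set (Set X)) :
    ∃ V : Ultrafilter (Finset X × Finset (Finset X)), ∀ T, independentSet T ∈ V ↔ T ∈ 𝒯 := by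
  classical
  obtain ⟨V, hV⟩ := Ultrafilter.exists_ultrafilter_of_finite_inter_nonempty
    (Set.range fun T : Set X => {p | p ∈ independentSet T ↔ T ∈ 𝒯}) (by
      intro t ht
      rw [← Set.image_univ, Finset.subset_set_image_iff] at ht
      obtain ⟨t, -, rfl⟩ := ht
      obtain ⟨p, hp⟩ := exists_mem_independentSet_iff t 𝒯
      exact ⟨p, by simpa using hp⟩)
  refine ⟨V, fun T => ?_⟩
  have h : {p | p ∈ independentSet T ↔ T ∈ 𝒯} ∈ V := hV ⟨T, rfl⟩
  by_cases hT : T ∈ 𝒯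
  · simpa [hT] using h
  · simp only [hT, iff_false] at h ⊢
    exact Ultrafilter.compl_mem_iff_notMem.1 h

theorem two_power_two_power_le_mk_ultrafilter (X : Type u) [Infinite X] :
    (2 : Cardinal) ^ ((2 : Cardinal) ^ #X) ≤ #(Ultrafilter X) := by
  choose V hV using exists_ultrafilter_independentSet_mem_iff (X := X)
  obtain ⟨e⟩ : Nonempty (Finset X × Finset (Finset X) ≃ X) := by
    rw [← Cardinal.eq]
    simp
  rw [← Cardinal.mk_set, ← Cardinal.mk_set]
  refine Cardinal.mk_le_of_injective (f := fun 𝒯 => (V 𝒯).map e) fun 𝒮 𝒯 h => ?_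
  ext T
  have h' : e.symm ⁻¹' independentSet T ∈ (V 𝒮).map e ↔
    e.symm ⁻¹' independentSet T ∈ (V 𝒯).map e := by rw [show (V 𝒮).map e = (V 𝒯).map e from h]
  simpa [Ultrafilter.mem_map, ← Set.preimage_comp, hV] using h'

theorem two_power_two_power_le_mk_nonprincipal (X : Type u) [Infinite X] :
    (2 : Cardinal) ^ ((2 : Cardinal) ^ #X) ≤ #{U : Ultrafilter X // ∀ a, {a} ∉ U} := by
  have hlt : #(Set.range (pure : X → Ultrafilter X)) < #(Ultrafilter X) :=
    Cardinal.mk_range_le.trans_lt <| (Cardinal.cantor _).trans <| (Cardinal.cantor _).trans_le <|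
      two_power_two_power_le_mk_ultrafilter X
  have : Infinite (Ultrafilter X) := Infinite.of_injective pure Ultrafilter.pure_injective
  refine (two_power_two_power_le_mk_ultrafilter X).trans ?_
  rw [← Cardinal.mk_compl_of_infinite _ hlt]
  refine Cardinal.mk_subtype_mono fun U hU a ha => hU ?_
  obtain ⟨x, -, hx⟩ := Ultrafilter.eq_pure_of_finite_mem (Set.finite_singleton a) ha
  exact ⟨x, hx.symm⟩

theorem mk_operation_le (X : Type u) [Infinite X] : #(Operation X) ≤ 2 ^ #X := by
  have h : ∀ n : ℕ, #((Fin (n + 1) → X) → X) = 2 ^ #X := fun n => by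
    have hn : #(Fin (n + 1) → X) = #X := by
      rw [Cardinal.mk_arrow, Cardinal.mk_fin, Cardinal.lift_uzero, Cardinal.lift_natCast,
        Cardinal.power_natCast, Cardinal.power_nat_eq (aleph0_le_mk X) (Nat.succ_pos n)]
    rw [← Cardinal.power_def X (Fin (n + 1) → X), hn, Cardinal.power_self_eq (aleph0_le_mk X)]
  have hX : ℵ₀ ≤ 2 ^ #X := (aleph0_le_mk X).trans (Cardinal.cantor _).le
  rw [Cardinal.mk_sigma]
  simp only [h, Cardinal.sum_const, Cardinal.mk_nat, Cardinal.lift_aleph0, Cardinal.lift_uzero]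
  exact Cardinal.mul_le_of_le hX hX le_rfl

theorem stmt0 (X : Type u) [Infinite X] :
    #{C : Set (Operation X) // PrecompleteClone C} = (2 : Cardinal) ^ ((2 : Cardinal) ^ #X) := by
  apply le_antisymm
  · refine (Cardinal.mk_subtype_le _).trans ?_
    rw [Cardinal.mk_set]
    exact Cardinal.power_le_power_left two_ne_zero (mk_operation_le X)
  · refine (two_power_two_power_le_mk_nonprincipal X).trans ?_
    exact Cardinal.mk_le_of_injective
      (f := fun U => ⟨ultrafilterClone U.1, precompleteClone_ultrafilterClone U.2⟩)
      fun U V h => Subtype.ext (ultrafilterClone_injective (congrArg Subtype.val h))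
end

section
/- Let X be an infinite set and let I ⊆ P(X) be a maximal ideal containing all finite subsets of X. Then C_I := ⋃_{n≥1} { f ∈ O^(n)(X) : for every A ∈ I, f[A^n] ∈ I } is a clone on X and C_I ≠ O(X). -/
open Cardinal Set

universe u v

def opImageOn {X : Type u} (op : Operation X) (A : Set X) : Set X :=
  op.2 '' {x : Fin (op.1 + 1) → X | ∀ i, x i ∈ A}

def CIdeal {X : Type u} (I : Set (Set X)) : Set (Operation X) :=
  {op | ∀ A ∈ I, opImageOn op A ∈ I}

theorem isClone_CIdeal {X : Type u} (I : Set (Set X))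
    (hdown : ∀ A B : Set X, A ⊆ B → B ∈ I → A ∈ I)
    (hunion : ∀ A B : Set X, A ∈ I → B ∈ I → A ∪ B ∈ I)
    (hempty : ∅ ∈ I) : IsClone (CIdeal I) := by
  refine ⟨fun n k A hA => hdown _ A ?_ hA, fun n m g f hg hf A hA => ?_⟩
  · rintro _ ⟨x, hx, rfl⟩
    exact hx k
  · have hB : (⋃ i, opImageOn ⟨n, f i⟩ A) ∈ I := by
      have key : ∀ s : Finset (Fin (m + 1)), (⋃ i ∈ s, opImageOn ⟨n, f i⟩ A) ∈ I := by
        intro s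
        induction s using Finset.induction_on with
        | empty => simpa using hempty
        | insert a s _ ih =>
          rw [Finset.set_biUnion_insert]
          exact hunion _ _ (hf a A hA) ih
      simpa using key Finset.univ
    refine hdown _ _ ?_ (hg _ hB)
    rintro _ ⟨x, hx, rfl⟩
    exact ⟨fun i => f i x, fun i => mem_iUnion.2 ⟨i, x, hx, rfl⟩, rfl⟩

theorem exists_injective_range_mem {X : Type u} [Infinite X] (I : Set (Set X))
    (hdown : ∀ A B : Set X, A ⊆ B → B ∈ I → A ∈ I)
    (hmax : ∀ A : Set X, A ∈ I ∨ Aᶜ ∈ I) :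
    ∃ h : X → X, Function.Injective h ∧ range h ∈ I := by
  have hcard : #(X ⊕ X) = #X := by
    rw [mk_sum, lift_id, add_eq_self (aleph0_le_mk X)]
  obtain ⟨e⟩ := Cardinal.eq.1 hcard
  rcases hmax (range (e ∘ Sum.inl)) with h | h
  · exact ⟨_, e.injective.comp Sum.inl_injective, h⟩
  · refine ⟨_, e.injective.comp Sum.inr_injective, hdown _ _ ?_ h⟩
    rintro _ ⟨x, rfl⟩ ⟨y, hy⟩
    exact Sum.inl_ne_inr (e.injective hy)

theorem CIdeal_ne_univ {X : Type u} [Nonempty X] (I : Set (Set X)) (hproper : Set.univ ∉ I)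
    {h : X → X} (hinj : Function.Injective h) (hmem : range h ∈ I) : CIdeal I ≠ Set.univ := by
  intro hC
  have hu : unaryOp (Function.invFun h) ∈ CIdeal I := hC ▸ mem_univ _
  refine hproper ?_
  convert hu _ hmem
  refine (eq_univ_of_forall fun x => ?_).symm
  exact ⟨fun _ => h x, fun _ => mem_range_self x, Function.leftInverse_invFun hinj x⟩

theorem stmt1 {X : Type u} [Infinite X] (I : Set (Set X))
    (hdown : ∀ A B : Set X, A ⊆ B → B ∈ I → A ∈ I)
    (hunion : ∀ A B : Set X, A ∈ I → B ∈ I → A ∪ B ∈ I)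
    (hproper : Set.univ ∉ I)
    (hmax : ∀ A : Set X, A ∈ I ∨ Aᶜ ∈ I)
    (hfin : ∀ A : Set X, A.Finite → A ∈ I) :
    IsClone (CIdeal I) ∧ CIdeal I ≠ Set.univ := by
  obtain ⟨h, hinj, hmem⟩ := exists_injective_range_mem I hdown hmax
  exact ⟨isClone_CIdeal I hdown hunion (hfin ∅ finite_empty), CIdeal_ne_univ I hproper hinj hmem⟩
end

section
/- Let X be an infinite set and let I ⊆ P(X) be a maximal ideal containing all finite subsets of X, and let C_I := ⋃_{n≥1} { f ∈ O^(n)(X) : for every A ∈ I, f[A^n] ∈ I }. Then C_I is a precomplete clone: for every f ∈ O(X) ∖ C_I, the smallest clone containing C_I ∪ {f} is all of O(X). -/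
open Cardinal Set

universe u v

theorem mem_CIdeal_of_mapsTo {X : Type u} {I : Set (Set X)}
    (hdown : ∀ A B : Set X, A ⊆ B → B ∈ I → A ∈ I) {B : Set X} (hB : B ∈ I) {n : ℕ}
    {f : (Fin (n + 1) → X) → X} (hf : ∀ x, f x ∈ B) : (⟨n, f⟩ : Operation X) ∈ CIdeal I :=
  fun _ _ => hdown _ B (Set.image_subset_iff.2 fun x _ => hf x) hB

theorem mem_CIdeal_of_conservative {X : Type u} {I : Set (Set X)}
    (hdown : ∀ A B : Set X, A ⊆ B → B ∈ I → A ∈ I) {n : ℕ}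
    {f : (Fin (n + 1) → X) → X} (hf : ∀ x, ∃ i, f x = x i) :
    (⟨n, f⟩ : Operation X) ∈ CIdeal I :=
  fun A hA => hdown _ A (Set.image_subset_iff.2 fun x hx => by
    obtain ⟨i, hi⟩ := hf x
    exact (congrArg (· ∈ A) hi).mpr (hx i)) hA

/-- If `op` maps tuples from some `A ∈ I` onto `B`, then every operation with values in `B`
factors through `op` and operations with values in `A`. -/
theorem IsClone.mem_of_forall_mem_opImageOn {X : Type u} {I : Set (Set X)}
    (hdown : ∀ A B : Set X, A ⊆ B → B ∈ I → A ∈ I) {C : Set (Operation X)} (hC : IsClone C)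
    (hIC : CIdeal I ⊆ C) {op : Operation X} (hop : op ∈ C) {A : Set X} (hA : A ∈ I) {n : ℕ}
    {h : (Fin (n + 1) → X) → X} (hh : ∀ x, h x ∈ opImageOn op A) :
    (⟨n, h⟩ : Operation X) ∈ C := by
  choose s hsA hs using hh
  have key := hC.2 n op.1 op.2 (fun i x => s x i) hop
    fun i => hIC (mem_CIdeal_of_mapsTo hdown hA fun x => hsA x i)
  rwa [show h = fun x => op.2 fun i => s x i from funext fun x => (hs x).symm]

theorem stmt2 {X : Type u} [Infinite X] (I : Set (Set X))
    (hdown : ∀ A B : Set X, A ⊆ B → B ∈ I → A ∈ I)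
    (hunion : ∀ A B : Set X, A ∈ I → B ∈ I → A ∪ B ∈ I)
    (hproper : Set.univ ∉ I)
    (hmax : ∀ A : Set X, A ∈ I ∨ Aᶜ ∈ I)
    (hfin : ∀ A : Set X, A.Finite → A ∈ I) :
    ∀ op : Operation X, op ∉ CIdeal I → cloneGen (CIdeal I ∪ {op}) = Set.univ := by
  classical
  intro op hop
  refine Set.eq_univ_of_forall ?_
  rintro ⟨n, h⟩ C ⟨hC, hsub⟩
  have hIC : CIdeal I ⊆ C := Set.subset_union_left.trans hsub
  have hopC : op ∈ C := hsub (Or.inr rfl)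
  obtain ⟨A, hA, hB⟩ : ∃ A ∈ I, opImageOn op A ∉ I := by
    simpa [CIdeal] using hop
  set B := opImageOn op A with hBdef
  obtain ⟨p, hp⟩ : B.Nonempty :=
    Set.nonempty_iff_ne_empty.2 fun h0 => hB (h0 ▸ hfin ∅ Set.finite_empty)
  have h_inside : (⟨n, fun x => if h x ∈ B then h x else p⟩ : Operation X) ∈ C :=
    hC.mem_of_forall_mem_opImageOn hdown hIC hopC hA fun x => by
      rw [← hBdef]
      split_ifs with hx
      exacts [hx, hp]
  have h_outside : (⟨n, fun x => if h x ∈ B then p else h x⟩ : Operation X) ∈ C :=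
    hIC (mem_CIdeal_of_mapsTo hdown
      (hunion _ _ ((hmax B).resolve_left hB) (hfin {p} (Set.finite_singleton p))) fun x => by
        split_ifs with hx
        exacts [Or.inr rfl, Or.inl hx])
  have h_glue : (⟨1, fun y => if y 1 = p then y 0 else y 1⟩ : Operation X) ∈ C :=
    hIC (mem_CIdeal_of_conservative hdown fun y => by
      split_ifs
      exacts [⟨0, rfl⟩, ⟨1, rfl⟩])
  have key := hC.2 n 1 _
    ![fun x => if h x ∈ B then h x else p, fun x => if h x ∈ B then p else h x] h_glue
    (Fin.forall_fin_two.2 ⟨h_inside, h_outside⟩)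
  convert key using 2
  funext x
  by_cases hx : h x ∈ B
  · simp [hx]
  · simp [hx, ne_of_mem_of_not_mem hp hx |>.symm]
end

section
/- Let X be an infinite set and let f : X × X → X be a pairing function. Then there exist unary functions g, g_1, g_2 : X → X such that the function (x,y) ↦ g(f(g_1(x), g_2(y))) is a bijection from X × X onto X. -/
open Cardinal Set

universe u v

theorem stmt4 {X : Type u} [Infinite X] (f : X → X → X) (hf : IsPairing f) :
    ∃ g g₁ g₂ : X → X,
      Function.Bijective (fun p : X × X => g (f (g₁ p.1) (g₂ p.2))) := by
  obtain ⟨s⟩ : Nonempty (X ⊕ X ≃ X) := by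
    rw [← Cardinal.eq, Cardinal.mk_sum, Cardinal.lift_id, Cardinal.add_mk_eq_self]
  obtain ⟨e⟩ : Nonempty (X × X ≃ X) := by
    rw [← Cardinal.eq, Cardinal.mk_prod, Cardinal.lift_id,
      Cardinal.mul_eq_self (Cardinal.aleph0_le_mk X)]
  have hinj : Function.Injective fun p : X × X => f (s (.inl p.1)) (s (.inr p.2)) := by
    rintro ⟨x, y⟩ ⟨x', y'⟩ h
    obtain ⟨h₁, h₂⟩ := hf (by simp) (by simp) h
    simpa using And.intro h₁ h₂
  refine ⟨fun z => e (Function.invFun (fun p : X × X => f (s (.inl p.1)) (s (.inr p.2))) z),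
    fun x => s (.inl x), fun y => s (.inr y), ?_⟩
  convert e.bijective using 2 with p
  exact congrArg e (Function.leftInverse_invFun hinj p)
end

section
/- Let X be an infinite set and let C be a clone on X that contains all unary functions O^(1)(X) and contains some pairing function pr : X × X → X. Then C = O(X). -/
open Cardinal Set

universe u v

theorem IsClone.unaryOp_comp_mem {X : Type u} {C : Set (Operation X)} (hC : IsClone C) {n : ℕ}
    {u : X → X} {f : (Fin (n + 1) → X) → X} (hu : unaryOp u ∈ C)
    (hf : (⟨n, f⟩ : Operation X) ∈ C) : (⟨n, fun x => u (f x)⟩ : Operation X) ∈ C :=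
  hC.2 n 0 (fun x => u (x 0)) (fun _ => f) hu fun _ => hf

theorem IsClone.binOp_comp_mem {X : Type u} {C : Set (Operation X)} (hC : IsClone C) {n : ℕ}
    {p : X → X → X} {f g : (Fin (n + 1) → X) → X} (hp : binOp p ∈ C)
    (hf : (⟨n, f⟩ : Operation X) ∈ C) (hg : (⟨n, g⟩ : Operation X) ∈ C) :
    (⟨n, fun x => p (f x) (g x)⟩ : Operation X) ∈ C :=
  hC.2 n 1 (fun x => p (x 0) (x 1)) ![f, g] hp (Fin.forall_fin_two.2 ⟨hf, hg⟩)

theorem IsClone.exists_injective_binOp_mem {X : Type u} [Infinite X] {C : Set (Operation X)}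
    (hC : IsClone C) (hU : ∀ f : X → X, unaryOp f ∈ C) {pr : X → X → X} (hpr : IsPairing pr)
    (hprC : binOp pr ∈ C) : ∃ p : X → X → X, Function.Injective2 p ∧ binOp p ∈ C := by
  obtain ⟨e⟩ : Nonempty (X ⊕ X ≃ X) := by
    rw [← Cardinal.eq, Cardinal.mk_sum, Cardinal.lift_id,
      Cardinal.add_eq_self (Cardinal.aleph0_le_mk X)]
  refine ⟨fun x y => pr (e (.inl x)) (e (.inr y)), fun x x' y y' h => ?_,
    hC.binOp_comp_mem hprC (hC.unaryOp_comp_mem (hU fun x => e (.inl x)) (hC.1 1 0))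
      (hC.unaryOp_comp_mem (hU fun y => e (.inr y)) (hC.1 1 1))⟩
  simpa using hpr (by simp) (by simp) h

theorem IsClone.exists_injective_mem {X : Type u} {C : Set (Operation X)} (hC : IsClone C)
    {p : X → X → X} (hp : Function.Injective2 p) (hpC : binOp p ∈ C) (n : ℕ) :
    ∃ h : (Fin (n + 1) → X) → X, Function.Injective h ∧ (⟨n, h⟩ : Operation X) ∈ C := by
  induction n with
  | zero =>
    refine ⟨fun x => x 0, fun x y h => funext fun i => ?_, hC.1 0 0⟩
    rwa [Fin.fin_one_eq_zero i]
  | succ n ih =>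
    obtain ⟨h, hinj, hmem⟩ := ih
    refine ⟨fun x => p (h fun i => x i.castSucc) (x (Fin.last _)), fun x y hxy => ?_,
      hC.binOp_comp_mem hpC
        (hC.2 (n + 1) n h (fun i x => x i.castSucc) hmem fun i => hC.1 _ _) (hC.1 _ _)⟩
    obtain ⟨hinit, hlast⟩ := hp hxy
    exact funext fun i => Fin.lastCases hlast (fun j => congrFun (hinj hinit) j) i

theorem stmt5 {X : Type u} [Infinite X] (C : Set (Operation X)) (hC : IsClone C)
    (hU : ∀ f : X → X, unaryOp f ∈ C)
    (pr : X → X → X) (hpr : IsPairing pr) (hprC : binOp pr ∈ C) :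
    C = Set.univ := by
  refine Set.eq_univ_of_forall fun ⟨n, f⟩ => ?_
  obtain ⟨p, hp, hpC⟩ := hC.exists_injective_binOp_mem hU hpr hprC
  obtain ⟨h, hinj, hmem⟩ := hC.exists_injective_mem hp hpC n
  have key := hC.unaryOp_comp_mem (hU fun x => f (Function.invFun h x)) hmem
  simpa only [Function.leftInverse_invFun hinj _] using key
end

section
/- Let X be a set and let C be a precomplete clone on X with C^(1) ≠ O^(1)(X). Then C = Pol(C^(1)), where C^(1) is regarded as a relation R ⊆ X^X (with index set I = X). -/
open Cardinal Set

universe u v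

theorem isClone_Pol {X : Type u} {I : Type v} (R : Set (I → X)) : IsClone (Pol R) := by
  refine ⟨fun n k ρ hρ => hρ k, fun n m g f hg hf ρ hρ => ?_⟩
  exact hg (fun j i => f j fun k => ρ k i) fun j => hf j ρ hρ

theorem IsClone.subset_Pol_unary {X : Type u} {C : Set (Operation X)} (hC : IsClone C) :
    C ⊆ Pol {f : X → X | unaryOp f ∈ C} := by
  rintro ⟨m, g⟩ hg ρ hρ
  exact hC.2 0 m g (fun j x => ρ j (x 0)) hg hρ

theorem mem_of_unaryOp_mem_Pol {X : Type u} {R : Set (X → X)} (hid : id ∈ R) {f : X → X}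
    (hf : unaryOp f ∈ Pol R) : f ∈ R :=
  hf (fun _ => id) fun _ => hid

theorem stmt6 {X : Type u} (C : Set (Operation X)) (hC : PrecompleteClone C)
    (h1 : {f : X → X | unaryOp f ∈ C} ≠ Set.univ) :
    C = Pol {f : X → X | unaryOp f ∈ C} := by
  obtain ⟨hclone, -, hmax⟩ := hC
  rcases hmax _ (isClone_Pol _) hclone.subset_Pol_unary with h | h
  · exact h.symm
  · refine absurd (Set.eq_univ_of_forall fun f => ?_) h1
    exact mem_of_unaryOp_mem_Pol (hclone.1 0 0) (h ▸ Set.mem_univ (unaryOp f))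
end

section
/- Let X be a set and let C be a precomplete clone on X with C^(1) = O^(1)(X). Then C^(2) ≠ O^(2)(X) and C = Pol(C^(2)), where C^(2) is regarded as a relation R ⊆ X^(X×X) (with index set I = X × X). -/
open Cardinal Set

universe u v

theorem IsClone.unary_comp {X : Type u} {C : Set (Operation X)} (hC : IsClone C) {f : X → X}
    (hf : unaryOp f ∈ C) {n : ℕ} {g : (Fin (n + 1) → X) → X} (hg : (⟨n, g⟩ : Operation X) ∈ C) :
    (⟨n, fun x => f (g x)⟩ : Operation X) ∈ C :=
  hC.2 n 0 (fun x => f (x 0)) (fun _ => g) hf fun _ => hg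

theorem IsClone.binary_comp {X : Type u} {C : Set (Operation X)} (hC : IsClone C)
    {f : X → X → X} (hf : binOp f ∈ C) {n : ℕ} {g h : (Fin (n + 1) → X) → X}
    (hg : (⟨n, g⟩ : Operation X) ∈ C) (hh : (⟨n, h⟩ : Operation X) ∈ C) :
    (⟨n, fun x => f (g x) (h x)⟩ : Operation X) ∈ C :=
  hC.2 n 1 (fun x => f (x 0) (x 1)) ![g, h] hf fun i => by
    fin_cases i
    · exact hg
    · exact hh

/-- A clone with all binary operations over an infinite set contains, for each set `s` of
coordinates, an operation whose value determines the arguments at `s`. -/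
theorem IsClone.exists_separating {X : Type u} [Infinite X] {C : Set (Operation X)}
    (hC : IsClone C) (h2 : ∀ f : X → X → X, binOp f ∈ C) (n : ℕ) (s : Finset (Fin (n + 1))) :
    ∃ g : (Fin (n + 1) → X) → X, (⟨n, g⟩ : Operation X) ∈ C ∧
      ∀ x y, g x = g y → ∀ i ∈ s, x i = y i := by
  obtain ⟨e⟩ : Nonempty (X × X ≃ X) :=
    Cardinal.eq.1 (by simp)
  induction s using Finset.induction_on with
  | empty => exact ⟨fun x => x 0, hC.1 n 0, by simp⟩
  | insert a s _ ih =>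
    obtain ⟨g, hg, hinj⟩ := ih
    refine ⟨fun x => e (x a, g x),
      hC.binary_comp (h2 fun u v => e (u, v)) (hC.1 n a) hg, fun x y hxy i hi => ?_⟩
    have h := Prod.mk.inj (e.injective hxy)
    rcases Finset.mem_insert.1 hi with rfl | hi
    · exact h.1
    · exact hinj x y h.2 i hi

open Classical in
theorem IsClone.indicator_mem {X : Type u} {C : Set (Operation X)}
    (hC : IsClone C) (h1 : ∀ f : X → X, unaryOp f ∈ C) (h2 : ∀ f : X → X → X, binOp f ∈ C)
    (n : ℕ) (a : Fin (n + 1) → X) (c z : X) (s : Finset (Fin (n + 1))) :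
    (⟨n, fun x => if ∀ i ∈ s, x i = a i then c else z⟩ : Operation X) ∈ C := by
  induction s using Finset.induction_on with
  | empty => simpa using hC.unary_comp (h1 fun _ => c) (hC.1 n 0)
  | insert b s _ ih =>
    convert hC.binary_comp (h2 fun u v => if u = a b then v else z) (hC.1 n b) ih using 3 with x
    simp only [Finset.forall_mem_insert, ite_and]

open Classical in
theorem IsClone.restrict_mem {X : Type u} {C : Set (Operation X)}
    (hC : IsClone C) (h1 : ∀ f : X → X, unaryOp f ∈ C) (h2 : ∀ f : X → X → X, binOp f ∈ C)
    (n : ℕ) (f : (Fin (n + 1) → X) → X) (z : X) (S : Finset (Fin (n + 1) → X)) :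
    (⟨n, fun x => if x ∈ S then f x else z⟩ : Operation X) ∈ C := by
  induction S using Finset.induction_on with
  | empty => simpa using hC.unary_comp (h1 fun _ => z) (hC.1 n 0)
  | insert a S ha ih =>
    convert hC.binary_comp (h2 fun u v => if u = z then v else u)
      (hC.indicator_mem h1 h2 n a (f a) z Finset.univ) ih using 3 with x
    have hxa : (∀ i ∈ Finset.univ, x i = a i) ↔ x = a := by simp [funext_iff]
    simp only [hxa, Finset.mem_insert]
    by_cases hx : x = a
    · subst hx
      simp +contextual [ha]
    · simp [hx]

/-- **Sierpiński's theorem**: the binary operations generate all operations. -/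
theorem IsClone.eq_univ_of_binary {X : Type u} {C : Set (Operation X)}
    (hC : IsClone C) (h1 : ∀ f : X → X, unaryOp f ∈ C) (h2 : ∀ f : X → X → X, binOp f ∈ C) :
    C = Set.univ := by
  refine Set.eq_univ_of_forall ?_
  rintro ⟨n, f⟩
  rcases finite_or_infinite X with hX | hX
  · rcases isEmpty_or_nonempty X with hE | ⟨⟨z⟩⟩
    · convert hC.1 n 0 using 2
    · cases nonempty_fintype X
      classical
      simpa using hC.restrict_mem h1 h2 n f z Finset.univ
  · obtain ⟨g, hg, hinj⟩ := hC.exists_separating h2 n Finset.univ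
    have hg' : Function.Injective g :=
      fun x y h => funext fun i => hinj x y h i (Finset.mem_univ i)
    simpa only [Function.leftInverse_invFun hg' _] using
      hC.unary_comp (h1 fun y => f (Function.invFun g y)) hg

theorem stmt7 {X : Type u} (C : Set (Operation X)) (hC : PrecompleteClone C)
    (h1 : ∀ f : X → X, unaryOp f ∈ C) :
    {g : X × X → X | binOp (fun x y => g (x, y)) ∈ C} ≠ Set.univ ∧
    C = Pol {g : X × X → X | binOp (fun x y => g (x, y)) ∈ C} := by
  obtain ⟨hClone, hne, hmax⟩ := hC
  have hbin : {g : X × X → X | binOp (fun x y => g (x, y)) ∈ C} ≠ Set.univ := fun h =>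
    hne <| hClone.eq_univ_of_binary h1 fun f =>
      (h ▸ Set.mem_univ _ : (fun p : X × X => f p.1 p.2) ∈
        {g : X × X → X | binOp (fun x y => g (x, y)) ∈ C})
  refine ⟨hbin, ?_⟩
  have hsub : C ⊆ Pol {g : X × X → X | binOp (fun x y => g (x, y)) ∈ C} := by
    rintro ⟨m, f⟩ hf ρ hρ
    exact hClone.2 1 m f (fun j x => ρ j (x 0, x 1)) hf hρ
  rcases hmax _ (isClone_Pol _) hsub with h | h
  · exact h.symm
  · refine absurd (Set.eq_univ_of_forall fun g => ?_) hbin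
    have hg : binOp (fun x y => g (x, y)) ∈
        Pol {g : X × X → X | binOp (fun x y => g (x, y)) ∈ C} := h ▸ Set.mem_univ _
    refine hg ![Prod.fst, Prod.snd] fun j => ?_
    fin_cases j
    · exact hClone.1 1 0
    · exact hClone.1 1 1
end

section
/- Let λ be a regular infinite cardinal, X = λ, and let pr : λ × λ → λ be a pairing function such that |λ ∖ ran(pr)| = λ and 0 ∉ ran(pr). Define pr_Δ : λ × λ → λ by pr_Δ(x,y) = pr(x,y) if x > y and pr_Δ(x,y) = 0 otherwise. If C is a clone on λ containing all unary functions, containing pr_Δ, and containing some binary function that is not almost unary, then C = O(λ). -/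
open Cardinal Set

universe u v

namespace IsClone

variable {X : Type u} {C : Set (Operation X)}

theorem comp_unary (hC : IsClone C) {n : ℕ} {f : (Fin (n + 1) → X) → X} {u : X → X}
    (hu : unaryOp u ∈ C) (hf : (⟨n, f⟩ : Operation X) ∈ C) :
    (⟨n, fun x => u (f x)⟩ : Operation X) ∈ C :=
  hC.2 n 0 _ (fun _ => f) hu fun _ => hf

theorem comp_binary (hC : IsClone C) {n : ℕ} {f₁ f₂ : (Fin (n + 1) → X) → X} {g : X → X → X}
    (hg : binOp g ∈ C) (h₁ : (⟨n, f₁⟩ : Operation X) ∈ C) (h₂ : (⟨n, f₂⟩ : Operation X) ∈ C) :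
    (⟨n, fun x => g (f₁ x) (f₂ x)⟩ : Operation X) ∈ C :=
  hC.2 n 1 _ ![f₁, f₂] hg (Fin.forall_fin_two.2 ⟨h₁, h₂⟩)

/-- A clone containing an injective binary operation contains an injective operation of every
arity. -/
theorem exists_injective (hC : IsClone C) {P : X → X → X} (hP : binOp P ∈ C)
    (hinj : Function.Injective2 P) (n : ℕ) :
    ∃ p : (Fin (n + 1) → X) → X, (⟨n, p⟩ : Operation X) ∈ C ∧ Function.Injective p := by
  induction n with
  | zero =>
    refine ⟨fun x => x 0, hC.1 0 0, fun x y h => ?_⟩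
    funext i
    exact Fin.cases h (fun j => j.elim0) i
  | succ n ih =>
    obtain ⟨p, hpC, hp⟩ := ih
    refine ⟨fun x => P (x 0) (p fun i => x i.succ),
      hC.comp_binary hP (hC.1 _ 0) (hC.2 _ _ p _ hpC fun i => hC.1 _ i.succ), fun x y h => ?_⟩
    obtain ⟨h0, hs⟩ := hinj h
    funext i
    exact Fin.cases h0 (fun j => congrFun (hp hs) j) i

theorem eq_univ_of_injective2 (hC : IsClone C) (hU : ∀ f : X → X, unaryOp f ∈ C)
    {P : X → X → X} (hP : binOp P ∈ C) (hinj : Function.Injective2 P) : C = Set.univ := by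
  refine Set.eq_univ_of_forall ?_
  rintro ⟨n, f⟩
  obtain ⟨p, hpC, hp⟩ := hC.exists_injective hP hinj n
  have hf : f = fun x => Function.extend p f id (p x) := by
    funext x
    exact (hp.extend_apply f id x).symm
  rw [hf]
  exact hC.comp_unary (hU _) hpC

end IsClone

theorem exists_embeddings_of_card_eq {X : Type u} (hX : ℵ₀ ≤ #X) {S : Set X} (hS : #S = #X) :
    ∃ e₁ e₂ : X → X, Function.Injective e₁ ∧ Function.Injective e₂ ∧
      (∀ x, e₁ x ∈ S) ∧ (∀ x, e₂ x ∈ S) ∧ ∀ x y, e₁ x ≠ e₂ y := by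
  have hsum : #(X ⊕ X) = #S := by
    rw [mk_sum, lift_id, hS, add_eq_self hX]
  obtain ⟨e⟩ := Cardinal.eq.1 hsum
  have he : Function.Injective fun x => (e x : X) := Subtype.val_injective.comp e.injective
  exact ⟨fun x => e (.inl x), fun x => e (.inr x), he.comp Sum.inl_injective,
    he.comp Sum.inr_injective, fun x => (e _).2, fun x => (e _).2,
    fun x y h => Sum.inl_ne_inr (he h)⟩

theorem exists_disjoint_embeddings {X : Type u} (hX : ℵ₀ ≤ #X) {S T : Set X}
    (hS : #S = #X) (hT : #T = #X) :
    ∃ e₁ e₂ : X → X, Function.Injective e₁ ∧ Function.Injective e₂ ∧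
      (∀ x, e₁ x ∈ S) ∧ (∀ x, e₂ x ∈ T) ∧ ∀ x y, e₁ x ≠ e₂ y := by
  rcases (mk_set_le (S ∩ T)).eq_or_lt with h | h
  · obtain ⟨e₁, e₂, h₁, h₂, hm₁, hm₂, hne⟩ := exists_embeddings_of_card_eq hX h
    exact ⟨e₁, e₂, h₁, h₂, fun x => (hm₁ x).1, fun x => (hm₂ x).2, hne⟩
  · have hd : #↥(S \ T) = #X := by
      refine (mk_set_le _).antisymm (not_lt.1 fun hlt => ?_)
      have hle : #S ≤ #↥(S ∩ T) + #↥(S \ T) := by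
        conv_lhs => rw [← Set.inter_union_sdiff S T]
        exact mk_union_le _ _
      exact (hle.trans_lt (add_lt_of_lt hX h hlt)).ne hS
    obtain ⟨f₁⟩ := Cardinal.eq.1 hd
    obtain ⟨f₂⟩ := Cardinal.eq.1 hT
    refine ⟨fun x => f₁.symm x, fun x => f₂.symm x,
      Subtype.val_injective.comp f₁.symm.injective, Subtype.val_injective.comp f₂.symm.injective,
      fun x => (f₁.symm x).2.1, fun x => (f₂.symm x).2, fun x y h => (f₁.symm x).2.2 ?_⟩
    rw [show (f₁.symm x : X) = f₂.symm y from h]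
    exact (f₂.symm y).2

/-- An operation that is not almost unary has a large section in each of its variables. -/
theorem exists_large_sections {X : Type u} {g : X → X → X}
    (hg : ¬ almostUnary2 fun p : X × X => g p.1 p.2) :
    (∃ b, #↥(Set.range fun x => g x b) = #X) ∧ ∃ a, #↥(Set.range (g a)) = #X := by
  constructor
  · by_contra! h
    exact hg ⟨fun b => Set.range fun x => g x b, fun b => (mk_set_le _).lt_of_ne (h b),
      .inr fun p => ⟨p.1, rfl⟩⟩
  · by_contra! h
    exact hg ⟨fun a => Set.range (g a), fun a => (mk_set_le _).lt_of_ne (h a),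
      .inl fun p => ⟨p.2, rfl⟩⟩

theorem stmt8 {X : Type u} [LinearOrder X] [WellFoundedLT X]
    (hreg : (#X).IsRegular)
    (hsmall : ∀ x : X, #{y : X | y < x} < #X)
    (pr : X → X → X) (hpr : IsPairing pr)
    (z : X) (hz : ∀ x : X, z ≤ x)
    (hzran : z ∉ Set.range fun p : X × X => pr p.1 p.2)
    (hcompl : #↥((Set.range fun p : X × X => pr p.1 p.2)ᶜ) = #X)
    (C : Set (Operation X)) (hC : IsClone C)
    (hU : ∀ f : X → X, unaryOp f ∈ C)
    (hprd : binOp (fun x y => if y < x then pr x y else z) ∈ C)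
    (hbin : ∃ g : X → X → X, binOp g ∈ C ∧ ¬ almostUnary2 (fun p => g p.1 p.2)) :
    C = Set.univ := by
  classical
  have hX : ℵ₀ ≤ #X := hreg.aleph0_le
  obtain ⟨g, hgC, hg⟩ := hbin
  obtain ⟨⟨b, hb⟩, a, ha⟩ := exists_large_sections hg
  obtain ⟨e₁, e₂, he₁, he₂, hm₁, hm₂, hne⟩ := exists_disjoint_embeddings hX hb ha
  choose u hu using hm₁
  choose v hv using hm₂
  obtain ⟨s, t, hs, ht, -, -, hst⟩ :=
    exists_embeddings_of_card_eq hX (S := Set.univ) mk_univ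
  let D : X → X → X := fun x y => if y < x then pr x y else z
  have hprz : ∀ x y, pr x y ≠ z := fun x y h => hzran ⟨(x, y), h⟩
  let P : X → X → X := fun x y =>
    g (Function.update u z a (D (s x) (t y))) (Function.update v z b (D (t y) (s x)))
  have hP : binOp P ∈ C := by
    have h₁ := hC.comp_unary (hU s) (hC.1 1 0)
    have h₂ := hC.comp_unary (hU t) (hC.1 1 1)
    exact hC.comp_binary (g := g) hgC (hC.comp_unary (hU _) (hC.comp_binary hprd h₁ h₂))
      (hC.comp_unary (hU _) (hC.comp_binary hprd h₂ h₁))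
  have hgt : ∀ x y, t y < s x → P x y = e₁ (pr (s x) (t y)) := fun x y h => by
    simpa [P, D, h, h.not_gt, hprz] using hu (pr (s x) (t y))
  have hlt : ∀ x y, s x < t y → P x y = e₂ (pr (t y) (s x)) := fun x y h => by
    simpa [P, D, h, h.not_gt, hprz] using hv (pr (t y) (s x))
  refine hC.eq_univ_of_injective2 hU hP fun x x' y y' h => ?_
  rcases lt_or_gt_of_ne (hst x y) with h₁ | h₁ <;> rcases lt_or_gt_of_ne (hst x' y') with h₂ | h₂
  · rw [hlt _ _ h₁, hlt _ _ h₂] at h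
    obtain ⟨h₃, h₄⟩ := hpr h₁.ne' h₂.ne' (he₂ h)
    exact ⟨hs h₄, ht h₃⟩
  · rw [hlt _ _ h₁, hgt _ _ h₂] at h
    exact (hne _ _ h.symm).elim
  · rw [hgt _ _ h₁, hlt _ _ h₂] at h
    exact (hne _ _ h).elim
  · rw [hgt _ _ h₁, hgt _ _ h₂] at h
    obtain ⟨h₃, h₄⟩ := hpr h₁.ne' h₂.ne' (he₁ h)
    exact ⟨hs h₃, ht h₄⟩
end

section
/- Let X be a set of regular infinite cardinality λ and let H be the set of all binary almost unary functions on X. Then Pol(H) is a precomplete clone on X that contains all unary functions. -/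
open Cardinal Set

universe u v

theorem mk_insert_lt_of_aleph0_le {X : Type u} {s : Set X} {c : Cardinal.{u}} (hc : ℵ₀ ≤ c)
    (a : X) (hs : #s < c) : #(insert a s : Set X) < c :=
  mk_insert_le.trans_lt (add_lt_of_lt hc hs (one_lt_aleph0.trans_le hc))

theorem fst_mem_AU2 {X : Type u} (hX : ℵ₀ ≤ #X) : (fun p : X × X => p.1) ∈ AU2 X :=
  ⟨fun x => {x}, fun x => by simpa using one_lt_aleph0.trans_le hX, Or.inl fun p => rfl⟩

theorem snd_mem_AU2 {X : Type u} (hX : ℵ₀ ≤ #X) : (fun p : X × X => p.2) ∈ AU2 X :=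
  ⟨fun x => {x}, fun x => by simpa using one_lt_aleph0.trans_le hX, Or.inr fun p => rfl⟩

theorem unaryOp_mem_Pol_AU2 {X : Type u} (f : X → X) : unaryOp f ∈ Pol (AU2 X) := by
  intro ρ hρ
  obtain ⟨G, hG, h⟩ := hρ 0
  exact ⟨fun x => f '' G x, fun x => mk_image_le.trans_lt (hG x),
    h.imp (fun h p => mem_image_of_mem f (h p)) fun h p => mem_image_of_mem f (h p)⟩

/-- A binary almost unary function preserves the set of binary almost unary functions. -/
theorem binOp_mem_Pol_AU2 {X : Type u} (hreg : (#X).IsRegular) {g : X × X → X} (hg : g ∈ AU2 X) :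
    binOp (fun x y => g (x, y)) ∈ Pol (AU2 X) := by
  intro ρ hρ
  obtain ⟨G, hG, h⟩ := hg
  obtain ⟨i, hi⟩ : ∃ i : Fin 2, ∀ x : Fin 2 → X, g (x 0, x 1) ∈ G (x i) :=
    h.elim (fun h => ⟨0, fun x => h (x 0, x 1)⟩) fun h => ⟨1, fun x => h (x 0, x 1)⟩
  obtain ⟨G', hG', h'⟩ := hρ i
  refine ⟨fun x => ⋃ z ∈ G' x, G z, fun x =>
    (card_biUnion_lt_iff_forall_of_isRegular hreg (hG' x)).2 fun z _ => hG z, ?_⟩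
  exact h'.imp (fun h' p => mem_biUnion (h' p) (hi fun j => ρ j p))
    fun h' p => mem_biUnion (h' p) (hi fun j => ρ j p)

theorem not_mem_AU2_of_injective {X : Type u} [Nonempty X] {g : X × X → X}
    (hg : Function.Injective g) : g ∉ AU2 X := by
  rintro ⟨G, hG, h | h⟩
  · let a := Classical.arbitrary X
    refine (hG a).not_ge (mk_le_of_injective (f := fun y => (⟨g (a, y), h (a, y)⟩ : G a)) ?_)
    intro y y' hy
    simpa using hg (Subtype.ext_iff.1 hy)
  · let a := Classical.arbitrary X
    refine (hG a).not_ge (mk_le_of_injective (f := fun y => (⟨g (y, a), h (y, a)⟩ : G a)) ?_)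
    intro y y' hy
    simpa using hg (Subtype.ext_iff.1 hy)

/-- A binary function that is not almost unary has a large row and a large column. -/
theorem exists_large_of_not_mem_AU2 {X : Type u} {g : X × X → X} (hg : g ∉ AU2 X) :
    (∃ a, #X ≤ #(range fun y => g (a, y))) ∧ ∃ b, #X ≤ #(range fun x => g (x, b)) := by
  constructor
  · by_contra! h
    exact hg ⟨fun a => range fun y => g (a, y), h, Or.inl fun p => ⟨p.2, rfl⟩⟩
  · by_contra! h
    exact hg ⟨fun b => range fun x => g (x, b), h, Or.inr fun p => ⟨p.1, rfl⟩⟩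

theorem exists_injective_disjoint {X : Type u} (hX : ℵ₀ ≤ #X) {S T : Set X}
    (hS : #X ≤ #S) (hT : #X ≤ #T) :
    ∃ u v : X → X, Function.Injective u ∧ Function.Injective v ∧
      (∀ x, u x ∈ S) ∧ (∀ x, v x ∈ T) ∧ ∀ x y, u x ≠ v y := by
  obtain ⟨k⟩ : Nonempty (X ⊕ X ↪ S) := by
    rw [← le_def, mk_sum, lift_id, add_eq_self hX]
    exact hS
  let S₁ : Set X := range fun x => (k (Sum.inl x) : X)
  have key : #X ≤ #(T \ S₁ : Set X) ∨ #X ≤ #(T ∩ S₁ : Set X) := by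
    by_contra! h
    have := (mk_union_le (T \ S₁) (T ∩ S₁)).trans_lt (add_lt_of_lt hX h.1 h.2)
    rw [sdiff_union_inter] at this
    exact this.not_ge hT
  obtain ⟨⟨v⟩⟩ | ⟨⟨v⟩⟩ := key.imp (fun h => le_def _ _ |>.1 h) fun h => le_def _ _ |>.1 h
  · refine ⟨fun x => k (Sum.inl x), fun x => v x, ?_, Subtype.val_injective.comp v.injective,
      fun x => (k _).2, fun x => (v x).2.1, fun x y h => (v y).2.2 ⟨x, h⟩⟩
    exact Subtype.val_injective.comp (k.injective.comp Sum.inl_injective)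
  · refine ⟨fun x => k (Sum.inr x), fun x => v x, ?_, Subtype.val_injective.comp v.injective,
      fun x => (k _).2, fun x => (v x).2.1, fun x y h => ?_⟩
    · exact Subtype.val_injective.comp (k.injective.comp Sum.inr_injective)
    · obtain ⟨z, hz⟩ := (v y).2.2
      have := k.injective (Subtype.ext (hz.trans h.symm))
      simp at this

/-- Composing a binary function that is not almost unary with suitable almost unary functions
yields an injection. -/
theorem exists_injective_comp {X : Type u} (hX : ℵ₀ ≤ #X) {g : X × X → X} (hg : g ∉ AU2 X) :
    ∃ f₁ ∈ AU2 X, ∃ f₂ ∈ AU2 X, Function.Injective fun p => g (f₁ p, f₂ p) := by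
  classical
  obtain ⟨⟨a, ha⟩, b, hb⟩ := exists_large_of_not_mem_AU2 hg
  obtain ⟨u, v, hu, hv, huS, hvT, huv⟩ := exists_injective_disjoint hX hb ha
  choose U hU using huS
  choose V hV using hvT
  obtain ⟨e⟩ : Nonempty (X × X ≃ X) := by
    rw [← Cardinal.eq, mk_prod, lift_id, mul_eq_self hX]
  obtain ⟨_, _, hord⟩ := exists_ord_eq_type_lt X
  have hIio (x : X) : #(Iio x) < #X := mk_Iio_lt x hord
  have hIic (x : X) : #(Iic x) < #X := by
    rw [← Iio_insert]
    exact mk_insert_lt_of_aleph0_le hX x (hIio x)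
  refine ⟨fun p => if p.2 < p.1 then U (e p) else a, ?_,
    fun p => if p.2 < p.1 then b else V (e p), ?_, ?_⟩
  · refine ⟨fun x => insert a ((fun y => U (e (x, y))) '' Iio x), fun x =>
      mk_insert_lt_of_aleph0_le hX a (mk_image_le.trans_lt (hIio x)), Or.inl fun p => ?_⟩
    dsimp only
    split_ifs with h
    · exact Or.inr ⟨p.2, h, rfl⟩
    · exact Or.inl rfl
  · refine ⟨fun y => insert b ((fun x => V (e (x, y))) '' Iic y), fun y =>
      mk_insert_lt_of_aleph0_le hX b (mk_image_le.trans_lt (hIic y)), Or.inr fun p => ?_⟩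
    dsimp only
    split_ifs with h
    · exact Or.inl rfl
    · exact Or.inr ⟨p.1, not_lt.1 h, rfl⟩
  · have hval (p : X × X) : g (if p.2 < p.1 then U (e p) else a, if p.2 < p.1 then b else V (e p)) =
        if p.2 < p.1 then u (e p) else v (e p) := by
      split_ifs
      · exact hU _
      · exact hV _
    intro p q hpq
    simp only [hval] at hpq
    split_ifs at hpq
    · exact e.injective (hu hpq)
    · exact (huv _ _ hpq).elim
    · exact (huv _ _ hpq.symm).elim
    · exact e.injective (hv hpq)

theorem IsClone.binOp_comp {X : Type u} {C : Set (Operation X)} (hC : IsClone C) {n : ℕ}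
    {g : X → X → X} {f₁ f₂ : (Fin (n + 1) → X) → X} (hg : binOp g ∈ C)
    (h₁ : (⟨n, f₁⟩ : Operation X) ∈ C) (h₂ : (⟨n, f₂⟩ : Operation X) ∈ C) :
    (⟨n, fun x => g (f₁ x) (f₂ x)⟩ : Operation X) ∈ C :=
  hC.2 n 1 (fun x => g (x 0) (x 1)) ![f₁, f₂] hg (Fin.forall_fin_two.2 ⟨h₁, h₂⟩)

/-- A clone containing all unary operations and a binary injection is the full clone. -/
theorem IsClone.eq_univ_of_injective {X : Type u} [Nonempty X] {C : Set (Operation X)}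
    (hC : IsClone C) (hun : ∀ f : X → X, unaryOp f ∈ C) {q : X × X → X}
    (hq : Function.Injective q) (hqC : binOp (fun x y => q (x, y)) ∈ C) : C = Set.univ := by
  have hinj (n : ℕ) : ∃ h : (Fin (n + 1) → X) → X,
      Function.Injective h ∧ (⟨n, h⟩ : Operation X) ∈ C := by
    induction n with
    | zero =>
      refine ⟨fun x => x 0, fun x y hxy => funext fun i => ?_, hC.1 0 0⟩
      rw [Fin.fin_one_eq_zero i]
      exact hxy
    | succ n ih =>
      obtain ⟨h, hh, hmem⟩ := ih
      refine ⟨fun x => q (h (fun i => x i.castSucc), x (Fin.last _)), fun x y hxy => ?_,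
        hC.binOp_comp hqC (hC.2 (n + 1) n h (fun i x => x i.castSucc) hmem
          fun i => hC.1 _ _) (hC.1 _ _)⟩
      have := Prod.ext_iff.1 (hq hxy)
      exact funext (Fin.lastCases this.2 fun i => congrFun (hh this.1) i)
  refine eq_univ_of_forall fun ⟨n, f⟩ => ?_
  obtain ⟨h, hh, hmem⟩ := hinj n
  have := hC.2 n 0 (fun x => f (Function.invFun h (x 0))) (fun _ => h)
    (hun fun x => f (Function.invFun h x)) fun _ => hmem
  simpa only [Function.leftInverse_invFun hh _] using this

theorem stmt9 {X : Type u} (hreg : (#X).IsRegular) :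
    PrecompleteClone (Pol (AU2 X)) ∧ ∀ f : X → X, unaryOp f ∈ Pol (AU2 X) := by
  have hX := hreg.aleph0_le
  have : Nonempty X := mk_ne_zero_iff.1 (aleph0_pos.trans_le hX).ne'
  refine ⟨⟨isClone_Pol _, fun huniv => ?_, fun D hD hPD => ?_⟩, unaryOp_mem_Pol_AU2⟩
  · obtain ⟨e⟩ : Nonempty (X × X ≃ X) := by
      rw [← Cardinal.eq, mk_prod, lift_id, mul_eq_self hX]
    have he : binOp (fun x y => e (x, y)) ∈ Pol (AU2 X) := huniv ▸ mem_univ _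
    exact not_mem_AU2_of_injective e.injective <|
      he ![fun p => p.1, fun p => p.2] (Fin.forall_fin_two.2 ⟨fst_mem_AU2 hX, snd_mem_AU2 hX⟩)
  · by_cases hDP : D ⊆ Pol (AU2 X)
    · exact Or.inl (hDP.antisymm hPD)
    right
    obtain ⟨⟨n, f⟩, hfD, hf⟩ := not_subset.1 hDP
    simp only [Pol, mem_ofPred_eq, not_forall] at hf
    obtain ⟨ρ, hρ, hg⟩ := hf
    obtain ⟨f₁, hf₁, f₂, hf₂, hinj⟩ := exists_injective_comp hX hg
    have hmem {h : X × X → X} (hh : h ∈ AU2 X) : binOp (fun x y => h (x, y)) ∈ D :=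
      hPD (binOp_mem_Pol_AU2 hreg hh)
    have hgD : binOp (fun x y => f fun j => ρ j (x, y)) ∈ D :=
      hD.2 1 n f (fun j x => ρ j (x 0, x 1)) hfD fun j => hmem (hρ j)
    exact hD.eq_univ_of_injective (fun h => hPD (unaryOp_mem_Pol_AU2 h)) hinj
      (hD.binOp_comp hgD (hmem hf₁) (hmem hf₂))
end

section
/- Let X be a set of regular infinite cardinality λ and let H be the set of all binary almost unary functions on X. If C is a precomplete clone on X with O^(1)(X) ⊆ C and C^(2) ⊆ H, then C = Pol(H). -/
open Cardinal Set

universe u v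

theorem mem_AU2_iff {X : Type u} (g : X × X → X) :
    g ∈ AU2 X ↔ (∀ a, #(Set.range fun y => g (a, y)) < #X) ∨
      (∀ b, #(Set.range fun x => g (x, b)) < #X) := by
  constructor
  · rintro ⟨G, hG, h | h⟩
    · exact Or.inl fun a => (mk_le_mk_of_subset (by rintro _ ⟨y, rfl⟩; exact h (a, y))).trans_lt (hG a)
    · exact Or.inr fun b => (mk_le_mk_of_subset (by rintro _ ⟨x, rfl⟩; exact h (x, b))).trans_lt (hG b)
  · rintro (h | h)
    · exact ⟨_, h, Or.inl fun p => ⟨p.2, rfl⟩⟩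
    · exact ⟨_, h, Or.inr fun p => ⟨p.1, rfl⟩⟩

/-- Finitely many functions of small range on a set of regular cardinality are simultaneously
constant on a subset of full cardinality. -/
theorem exists_injective_forall_eq {X : Type u} (hreg : (#X).IsRegular) {ι : Type*}
    (w : X → ι → X) (J : Finset ι) (hJ : ∀ j ∈ J, #(Set.range fun z => w z j) < #X) :
    ∃ k : X → X, Function.Injective k ∧ ∀ j ∈ J, ∀ z z', w (k z) j = w (k z') j := by
  classical
  induction J using Finset.induction_on with
  | empty => exact ⟨id, Function.injective_id, by simp⟩
  | insert j J _ ih =>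
    obtain ⟨k, hk, hkJ⟩ := ih fun i hi => hJ i (Finset.mem_insert_of_mem hi)
    obtain ⟨a, ha⟩ := infinite_pigeonhole_card
      (fun z => (⟨w (k z) j, k z, rfl⟩ : Set.range fun z => w z j)) #X le_rfl hreg.aleph0_le
      (by rw [hreg.cof_ord]; exact hJ j (Finset.mem_insert_self _ _))
    obtain ⟨e⟩ := ha
    have he (z : X) : w (k (e z)) j = a := congrArg Subtype.val (e z).2
    refine ⟨fun z => k (e z), hk.comp (Subtype.val_injective.comp e.injective), fun i hi z z' => ?_⟩
    rcases Finset.mem_insert.1 hi with rfl | hi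
    · rw [he, he]
    · exact hkJ i hi _ _

/-- If the range of `f ∘ r` is large and the coordinates of `r` satisfying `P` have small range,
then `f` already has large range after fixing those coordinates. -/
theorem exists_injective_comp_of_small_range {X : Type u} (hreg : (#X).IsRegular) {ι : Type*}
    [Fintype ι] (f : (ι → X) → X) (P : ι → Prop) (r : X → ι → X)
    (hP : ∀ j, P j → #(Set.range fun y => r y j) < #X)
    (hf : #X ≤ #(Set.range fun y => f (r y))) :
    ∃ (s : ι → X) (q : X → ι → X),
      (∀ z j, P j → q z j = s j) ∧ Function.Injective fun z => f (q z) := by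
  classical
  obtain ⟨e⟩ := hf
  choose σ hσ using fun z => (e z).2
  obtain ⟨k, hk, hkJ⟩ := exists_injective_forall_eq hreg (fun z => r (σ z))
    (Finset.univ.filter P) fun j hj => (mk_le_mk_of_subset (by
      rintro _ ⟨z, rfl⟩; exact ⟨σ z, rfl⟩)).trans_lt (hP j (Finset.mem_filter.1 hj).2)
  obtain ⟨z₀⟩ : Nonempty X := mk_ne_zero_iff.1 hreg.pos.ne'
  refine ⟨r (σ (k z₀)), fun z => r (σ (k z)),
    fun z j hj => hkJ j (Finset.mem_filter.2 ⟨Finset.mem_univ _, hj⟩) _ _, fun z z' h => ?_⟩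
  simp only [hσ] at h
  exact hk (e.injective (Subtype.ext h))

theorem mk_le_mk_range_of_injective_comp {X Y : Type u} (g : Y → X) (d : X → Y)
    (h : Function.Injective fun z => g (d z)) : #X ≤ #(Set.range g) :=
  mk_le_of_injective (f := fun z => (⟨g (d z), d z, rfl⟩ : Set.range g))
    fun _ _ hz => h (congrArg Subtype.val hz)

/-- An operation of which every binary minor, after unary substitutions, is almost unary
preserves the almost unary binary functions. -/
theorem mem_Pol_AU2 {X : Type u} (hreg : (#X).IsRegular) {n : ℕ} (f : (Fin (n + 1) → X) → X)
    (hf : ∀ (P : Fin (n + 1) → Prop) [DecidablePred P] (u : Fin (n + 1) → X → X),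
      (fun p : X × X => f fun j => if P j then u j p.1 else u j p.2) ∈ AU2 X) :
    (⟨n, f⟩ : Operation X) ∈ Pol (AU2 X) := by
  classical
  intro ρ hρ
  by_contra hnot
  rw [mem_AU2_iff] at hnot
  push Not at hnot
  obtain ⟨⟨a, ha⟩, b, hb⟩ := hnot
  let P : Fin (n + 1) → Prop := fun j => ∀ a, #(Set.range fun y => ρ j (a, y)) < #X
  obtain ⟨s, q, hqs, hq⟩ := exists_injective_comp_of_small_range hreg f P
    (fun y j => ρ j (a, y)) (fun j hj => hj a) ha
  obtain ⟨t, q', hqt, hq'⟩ := exists_injective_comp_of_small_range hreg f (fun j => ¬ P j)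
    (fun x j => ρ j (x, b)) (fun j hj => ((mem_AU2_iff _).1 (hρ j)).resolve_left hj b) hb
  obtain ⟨e⟩ : Nonempty (X ≃ Option X) := by
    rw [← Cardinal.eq, mk_option, add_one_eq hreg.aleph0_le]
  let u : Fin (n + 1) → X → X := fun j x =>
    if P j then (e x).elim (s j) (q' · j) else (e x).elim (t j) (q · j)
  rcases (mem_AU2_iff _).1 (hf P u) with h | h
  · refine (h (e.symm none)).not_ge (mk_le_mk_range_of_injective_comp _ (e.symm ∘ some) ?_)
    convert hq using 4 with z j
    by_cases hj : P j <;> simp [u, hj, hqs]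
  · refine (h (e.symm none)).not_ge (mk_le_mk_range_of_injective_comp _ (e.symm ∘ some) ?_)
    convert hq' using 4 with z j
    by_cases hj : P j <;> simp [u, hj, hqt]

theorem Pol_AU2_ne_univ {X : Type u} (hX : ℵ₀ ≤ #X) : Pol (AU2 X) ≠ Set.univ := by
  intro h
  obtain ⟨e⟩ : Nonempty (X × X ≃ X) := by
    rw [← Cardinal.eq, mk_prod, lift_id, mul_eq_self hX]
  have hsmall (x : X) : #({x} : Set X) < #X := by
    rw [mk_singleton]; exact one_lt_aleph0.trans_le hX
  have he : binOp (fun x y => e (x, y)) ∈ Pol (AU2 X) := h ▸ Set.mem_univ _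
  have hproj : ∀ j : Fin 2, (![Prod.fst, Prod.snd] : Fin 2 → X × X → X) j ∈ AU2 X := by
    intro j
    fin_cases j
    · exact ⟨fun x => {x}, hsmall, Or.inl fun _ => rfl⟩
    · exact ⟨fun x => {x}, hsmall, Or.inr fun _ => rfl⟩
  obtain ⟨x⟩ : Nonempty X := mk_ne_zero_iff.1 (aleph0_pos.trans_le hX).ne'
  rcases (mem_AU2_iff _).1 (he _ hproj) with h | h
  · refine (h x).not_ge (mk_le_mk_range_of_injective_comp _ id fun z z' hz => ?_)
    exact (Prod.mk.inj (e.injective hz)).2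
  · refine (h x).not_ge (mk_le_mk_range_of_injective_comp _ id fun z z' hz => ?_)
    exact (Prod.mk.inj (e.injective hz)).1

theorem stmt10 {X : Type u} (hreg : (#X).IsRegular)
    (C : Set (Operation X)) (hC : PrecompleteClone C)
    (hU : ∀ f : X → X, unaryOp f ∈ C)
    (h2 : ∀ g : X × X → X, binOp (fun x y => g (x, y)) ∈ C → g ∈ AU2 X) :
    C = Pol (AU2 X) := by
  obtain ⟨⟨hproj, hcomp⟩, -, hmax⟩ := hC
  have hsub : C ⊆ Pol (AU2 X) := by
    rintro ⟨n, f⟩ hfC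
    refine mem_Pol_AU2 hreg f fun P _ u => h2 _ (hcomp 1 n f _ hfC fun j => ?_)
    by_cases hj : P j
    · simp only [hj, if_true]
      exact hcomp 1 0 _ (fun _ x => x 0) (hU (u j)) fun _ => hproj 1 0
    · simp only [hj, if_false]
      exact hcomp 1 0 _ (fun _ x => x 1) (hU (u j)) fun _ => hproj 1 1
  exact ((hmax _ (isClone_Pol _) hsub).resolve_right (Pol_AU2_ne_univ hreg.aleph0_le)).symm
end

section
/- Let X be a set of regular infinite cardinality λ and let g ∈ O^(n)(X). Suppose every binary function in cl(g) (the smallest clone containing g and all unary functions) is almost unary. Then any two sets r, t ∈ S_g have nonempty intersection. -/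
open Cardinal Set

universe u v

def Sg {X : Type u} {n : ℕ} (g : (Fin (n + 1) → X) → X) :
    Set (Set (Fin (n + 1))) :=
  {s | ∃ a : Fin (n + 1) → X,
    #↥(g '' {x : Fin (n + 1) → X | ∀ i, i ∉ s → x i = a i}) = #X}

/-- Composing `g` with a selection, in each coordinate, of unary functions of one of two variables
yields a binary member of the clone generated by `g` and all unary functions. -/
theorem binOp_mem_cl {X : Type u} {n : ℕ} (g : (Fin (n + 1) → X) → X)
    (k : Fin (n + 1) → Fin 2) (P : Fin (n + 1) → X → X) (h : X → X → X)
    (hh : ∀ u v, h u v = g fun i => P i (![u, v] (k i))) :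
    binOp h ∈ cl {(⟨n, g⟩ : Operation X)} := by
  rintro C ⟨⟨hproj, hcomp⟩, hg, hun⟩
  have key := hcomp 1 n g (fun i x => P i (x (k i))) (hg rfl) fun i =>
    hcomp 1 0 (fun x => P i (x 0)) (fun _ x => x (k i)) (hun (P i)) fun _ => hproj 1 (k i)
  have e : binOp h = ⟨1, fun x => g fun i => P i (x (k i))⟩ := by
    unfold binOp
    congr 1
    funext x
    rw [hh]
    congr 1
    funext i
    congr 1
    match k i with
    | 0 => rfl
    | 1 => rfl
  rw [e]
  exact key

/-- If the image of `A` under `g` has full infinite cardinality, then some family indexed by `X`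
takes the value `b` at one index, lies in `A` at all others, and hits every value in `g '' A`. -/
theorem exists_family_through {X Y : Type u} (hX : ℵ₀ ≤ #X) (g : Y → X) (A : Set Y)
    (hA : #↥(g '' A) = #X) (b : Y) :
    ∃ (P : X → Y) (u₀ : X), P u₀ = b ∧ (∀ u, u ≠ u₀ → P u ∈ A) ∧
      ∀ z ∈ g '' A, ∃ u, u ≠ u₀ ∧ g (P u) = z := by
  have hcard : #X = #(Option ↥(g '' A)) := by
    rw [Cardinal.mk_option, hA, Cardinal.add_one_eq hX]
  obtain ⟨e⟩ := Cardinal.eq.1 hcard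
  have hsel : ∀ z : ↥(g '' A), ∃ y ∈ A, g y = z := fun z => z.2
  choose s hsA hs using hsel
  refine ⟨fun u => (e u).elim b s, e.symm none, by simp, fun u hu => ?_, fun z hz => ?_⟩
  · cases he : e u with
    | none => exact absurd (by rw [← he, e.symm_apply_apply]) hu
    | some z => simpa [he] using hsA z
  · exact ⟨e.symm (some ⟨z, hz⟩), by simp, by simp [hs]⟩

theorem stmt11 {X : Type u} (hreg : (#X).IsRegular) {n : ℕ}
    (g : (Fin (n + 1) → X) → X)
    (hbin : ∀ h : X → X → X, binOp h ∈ cl {(⟨n, g⟩ : Operation X)} →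
      almostUnary2 (fun p => h p.1 p.2)) :
    ∀ r ∈ Sg g, ∀ t ∈ Sg g, (r ∩ t).Nonempty := by
  classical
  rintro r ⟨a, ha⟩ t ⟨b, hb⟩
  by_contra hne
  have hdisj : ∀ i, i ∈ t → i ∉ r := fun i ht hr => hne ⟨i, hr, ht⟩
  obtain ⟨P, u₀, hPu₀, hPA, hPg⟩ := exists_family_through hreg.aleph0_le g _ ha b
  obtain ⟨Q, v₀, hQv₀, hQB, hQg⟩ := exists_family_through hreg.aleph0_le g _ hb a
  obtain ⟨G, hG, hl | hr⟩ := hbin (fun u v => g fun i => if i ∈ t then Q v i else P u i)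
    (binOp_mem_cl g (fun i => if i ∈ t then 1 else 0)
      (fun i x => if i ∈ t then Q x i else P x i) _ fun u v => by
        congr 1
        funext i
        by_cases hi : i ∈ t <;> simp [hi])
  · refine (hG u₀).not_ge (hb ▸ Cardinal.mk_le_mk_of_subset fun z hz => ?_)
    obtain ⟨v, hv, rfl⟩ := hQg z hz
    convert hl (u₀, v) using 2
    funext i
    by_cases hi : i ∈ t
    · simp [hi]
    · simpa [hi, hPu₀] using hQB v hv i hi
  · refine (hG v₀).not_ge (ha ▸ Cardinal.mk_le_mk_of_subset fun z hz => ?_)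
    obtain ⟨u, hu, rfl⟩ := hPg z hz
    convert hr (u, v₀) using 2
    funext i
    by_cases hi : i ∈ t
    · simpa [hi, hQv₀] using hPA u hu i (hdisj i hi)
    · simp [hi]
end

section
/- Let X be a set of regular infinite cardinality λ and let H be the set of all binary almost unary functions on X. If C is a clone on X with O^(1)(X) ⊆ C and C^(2) ⊆ H, then C ⊆ Pol(H); that is, whenever d_1,…,d_n ∈ H and g ∈ C^(n), the binary function (x,y) ↦ g(d_1(x,y),…,d_n(x,y)) is in H. -/
open Cardinal Set

universe u v

lemma mk_univ_pi_lt {X : Type u} {ι : Type} [Finite ι] {κ : Cardinal.{u}} (hκ : ℵ₀ ≤ κ)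
    {S : ι → Set X} (hS : ∀ j, #(S j) < κ) : #(Set.univ.pi S) < κ := by
  have := Fintype.ofFinite ι
  rw [Cardinal.mk_congr (Equiv.Set.univPi S), Cardinal.mk_pi, Cardinal.prod_eq_of_fintype,
    Cardinal.lift_uzero]
  exact Finset.prod_induction _ (· < κ) (fun _ _ => Cardinal.mul_lt_of_lt hκ)
    (Cardinal.one_lt_aleph0.trans_le hκ) fun j _ => hS j

lemma exists_le_mk_image_fiber {X : Type u} {ι : Type} [Finite ι] (hreg : (#X).IsRegular)
    {f : X → X} {t : X → ι → X} {S : ι → Set X} (hS : ∀ j, #(S j) < #X)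
    (ht : ∀ y j, t y j ∈ S j) (hf : #X ≤ #(Set.range f)) :
    ∃ c : ι → X, #X ≤ #(f '' {y | t y = c}) := by
  by_contra! h
  refine hf.not_gt ?_
  have hcover : Set.range f ⊆ ⋃ c ∈ Set.univ.pi S, f '' {y | t y = c} := by
    rintro _ ⟨y, rfl⟩
    exact Set.mem_biUnion (fun j _ => ht y j) ⟨y, rfl, rfl⟩
  refine (Cardinal.mk_le_mk_of_subset hcover).trans_lt ?_
  exact (Cardinal.card_biUnion_lt_iff_forall_of_isRegular hreg
    (mk_univ_pi_lt hreg.aleph0_le hS)).2 fun c _ => h c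

lemma IsClone.comp_binary_s12 {X : Type u} {C : Set (Operation X)} (hC : IsClone C)
    (hU : ∀ f : X → X, unaryOp f ∈ C) {n : ℕ} {g : (Fin (n + 1) → X) → X}
    (hg : (⟨n, g⟩ : Operation X) ∈ C) (k : Fin (n + 1) → Fin 2) (u : Fin (n + 1) → X → X) :
    (⟨1, fun z => g fun j => u j (z (k j))⟩ : Operation X) ∈ C :=
  hC.2 1 n g (fun j z => u j (z (k j))) hg fun j =>
    hC.2 1 0 (fun x => u j (x 0)) (fun _ z => z (k j)) (hU (u j)) fun _ => hC.1 1 (k j)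

theorem stmt12 {X : Type u} (hreg : (#X).IsRegular)
    (C : Set (Operation X)) (hC : IsClone C)
    (hU : ∀ f : X → X, unaryOp f ∈ C)
    (h2 : ∀ g : X × X → X, binOp (fun x y => g (x, y)) ∈ C → g ∈ AU2 X) :
    C ⊆ Pol (AU2 X) := by
  rintro ⟨n, g⟩ hg d hd
  classical
  choose D hDlt hD using hd
  let P : Fin (n + 1) → Prop := fun j => ∀ p : X × X, d j p ∈ D j p.1
  have hD₁ : ∀ j, P j → ∀ x y, d j (x, y) ∈ D j x := fun j hj x y => hj (x, y)
  have hD₂ : ∀ j, ¬P j → ∀ x y, d j (x, y) ∈ D j y := fun j hj x y =>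
    (hD j).resolve_left hj (x, y)
  have hone : ∀ x : X, #({x} : Set X) < #X := fun x => by
    rw [Cardinal.mk_singleton]
    exact Cardinal.one_lt_aleph0.trans_le hreg.aleph0_le
  let F : X × X → X := fun p => g fun j => d j p
  change almostUnary2 F
  by_contra hnot
  obtain ⟨a, ha⟩ : ∃ a, #X ≤ #(Set.range fun y => F (a, y)) := by
    by_contra! h
    exact hnot ⟨_, h, Or.inl fun p => ⟨p.2, rfl⟩⟩
  obtain ⟨b, hb⟩ : ∃ b, #X ≤ #(Set.range fun x => F (x, b)) := by
    by_contra! h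
    exact hnot ⟨_, h, Or.inr fun p => ⟨p.1, rfl⟩⟩
  obtain ⟨c, hc⟩ := exists_le_mk_image_fiber hreg
    (t := fun y j => if P j then d j (a, y) else a)
    (S := fun j => if P j then D j a else {a})
    (fun j => by split_ifs; exacts [hDlt j a, hone a])
    (fun y j => by split_ifs with hj; exacts [hD₁ j hj a y, rfl]) ha
  obtain ⟨c', hc'⟩ := exists_le_mk_image_fiber hreg
    (t := fun x j => if P j then b else d j (x, b))
    (S := fun j => if P j then {b} else D j b)
    (fun j => by split_ifs; exacts [hone b, hDlt j b])
    (fun x j => by split_ifs with hj; exacts [rfl, hD₂ j hj x b]) hb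
  let u : Fin (n + 1) → X → X := fun j z =>
    if P j then (if z = a then c j else d j (z, b)) else (if z = b then c' j else d j (a, z))
  obtain ⟨G, hG, hGF⟩ := h2 (fun p => g fun j => u j (![p.1, p.2] (if P j then 0 else 1))) (by
    convert hC.comp_binary_s12 hU hg (fun j => if P j then 0 else 1) u using 1
    unfold binOp
    congr! 5 with z j
    split_ifs <;> rfl)
  have hlt : ∀ x w : X, #(insert w (G x) : Set X) < #X := fun x w =>
    Cardinal.mk_insert_le.trans_lt (Cardinal.add_lt_of_lt hreg.aleph0_le (hG x)
      (Cardinal.one_lt_aleph0.trans_le hreg.aleph0_le))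
  rcases hGF with hGF | hGF
  · refine (hc.trans (Cardinal.mk_le_mk_of_subset ?_)).not_gt (hlt a (F (a, b)))
    rintro _ ⟨y, hy, rfl⟩
    by_cases hyb : y = b
    · exact Or.inl (by rw [hyb])
    · refine Or.inr ?_
      convert hGF (a, y) using 1
      refine congrArg g (funext fun j => ?_)
      have hyj : (if P j then d j (a, y) else a) = c j := congrFun hy j
      by_cases hj : P j
      · simpa [u, hj] using hyj
      · simp [u, hj, hyb]
  · refine (hc'.trans (Cardinal.mk_le_mk_of_subset ?_)).not_gt (hlt b (F (a, b)))
    rintro _ ⟨x, hx, rfl⟩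
    by_cases hxa : x = a
    · exact Or.inl (by rw [hxa])
    · refine Or.inr ?_
      convert hGF (x, b) using 1
      refine congrArg g (funext fun j => ?_)
      have hxj : (if P j then b else d j (x, b)) = c' j := congrFun hx j
      by_cases hj : P j
      · simp [u, hj, hxa]
      · simpa [u, hj] using hxj
end

section
/- Let λ be a regular infinite cardinal, let c : λ × λ → μ be a symmetric function witnessing Pr(λ,μ), let pr : λ × λ → λ be a pairing function with 0 ∉ ran(pr), and for A ⊆ μ let F_A be defined from c and pr as in the context. If A, B_1, …, B_k ⊆ μ and A ⊄ B_1 ∪ ⋯ ∪ B_k, then F_A ∉ cl({F_{B_1}, …, F_{B_k}}). -/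
open Cardinal Set

universe u v

section SeparatedPairs

variable {X : Type u} {M : Type v}

/-- The values at `α` and at `β` of the functions in `G` are distinct, different from `z`, and all
pairs of such values have colour `c₀`. -/
def SeparatedPair (c : X → X → M) (z : X) (c₀ : M) (G : Set (X → X)) (α β : X) : Prop :=
  ∀ g ∈ G, ∀ h ∈ G, g α ≠ h β ∧ g α ≠ z ∧ h β ≠ z ∧ c (g α) (h β) = c₀

/-- Every set of full cardinality has a subset of full cardinality on which, for some finite set of
injective functions, `t` depends on one variable only at all separated pairs. -/
def EssentiallyUnary (c : X → X → M) (z : X) (c₀ : M) (t : X → X → X) : Prop :=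
  ∀ S : Set X, #S = #X → ∃ S' ⊆ S, #S' = #X ∧ ∃ G : Set (X → X), G.Finite ∧
    (∀ g ∈ G, InjOn g S') ∧ ∃ w : X → X,
      (∀ α ∈ S', ∀ β ∈ S', SeparatedPair c z c₀ G α β → t α β = w α) ∨
      (∀ α ∈ S', ∀ β ∈ S', SeparatedPair c z c₀ G α β → t α β = w β)

theorem SeparatedPair.mono {c : X → X → M} {z : X} {c₀ : M} {G H : Set (X → X)} {α β : X}
    (h : SeparatedPair c z c₀ H α β) (hGH : G ⊆ H) : SeparatedPair c z c₀ G α β :=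
  fun g hg g' hg' => h g (hGH hg) g' (hGH hg')

theorem SeparatedPair.symm {c : X → X → M} (hc : ∀ x y, c x y = c y x) {z : X} {c₀ : M}
    {G : Set (X → X)} {α β : X} (h : SeparatedPair c z c₀ G α β) :
    SeparatedPair c z c₀ G β α := fun g hg g' hg' =>
  let ⟨h₁, h₂, h₃, h₄⟩ := h g' hg' g hg
  ⟨h₁.symm, h₃, h₂, (hc _ _).trans h₄⟩

theorem exists_subset_injOn_or_const (hreg : (#X).IsRegular) (f : X → X) {S : Set X}
    (hS : #S = #X) :
    ∃ S' ⊆ S, #S' = #X ∧ (InjOn f S' ∨ ∃ d, ∀ x ∈ S', f x = d) := by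
  rcases (mk_set_le (f '' S)).lt_or_eq with h | h
  · obtain ⟨a, t, hts, ht, hta⟩ := infinite_pigeonhole_set
      (fun x : S => (⟨f x, mem_image_of_mem f x.2⟩ : f '' S)) #X hS.ge hreg.aleph0_le
      (by rwa [hreg.cof_ord])
    exact ⟨t, hts, le_antisymm (mk_set_le t) ht, Or.inr ⟨a, fun x hx =>
      congrArg Subtype.val (hta hx)⟩⟩
  · obtain ⟨t, hts, ht⟩ := exists_subset_bijOn S f
    refine ⟨t, hts, ?_, Or.inl ht.injOn⟩
    rw [← mk_image_eq_of_injOn f t ht.injOn, ht.image_eq, h]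

theorem exists_subset_pairwise_not (hreg : (#X).IsRegular) (r : X → X → Prop)
    (hr : ∀ x y, r x y → r y x) {S : Set X} (hS : #S = #X) (hfin : ∀ x ∈ S, {y ∈ S | r x y}.Finite) :
    ∃ T ⊆ S, #T = #X ∧ T.Pairwise fun x y => ¬ r x y := by
  obtain ⟨T, hT⟩ := zorn_subset {T : Set X | T ⊆ S ∧ T.Pairwise fun x y => ¬ r x y} (by
    intro C hC hchain
    refine ⟨⋃₀ C, ⟨sUnion_subset fun t ht => (hC ht).1, ?_⟩, fun t ht => subset_sUnion_of_mem ht⟩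
    exact (pairwise_sUnion hchain.directedOn).2 fun t ht => (hC ht).2)
  refine ⟨T, hT.prop.1, ?_, hT.prop.2⟩
  by_contra hne
  have hlt : #T < #X := (mk_set_le T).lt_of_ne hne
  have hcover : S ⊆ T ∪ ⋃ x ∈ T, {y ∈ S | r x y} := by
    intro y hy
    by_contra hyn
    simp only [mem_union, mem_iUnion, mem_ofPred_eq, not_or, not_exists, not_and] at hyn
    have hins : insert y T ∈ {T : Set X | T ⊆ S ∧ T.Pairwise fun x y => ¬ r x y} := by
      refine ⟨insert_subset hy hT.prop.1, hT.prop.2.insert fun x hx _ => ⟨?_, hyn.2 x hx hy⟩⟩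
      exact fun h => hyn.2 x hx hy (hr y x h)
    exact hyn.1 (hT.le_of_ge hins (subset_insert y T) (mem_insert y T))
  have hU : #(⋃ x ∈ T, {y ∈ S | r x y} : Set X) < #X :=
    (card_biUnion_lt_iff_forall_of_isRegular hreg hlt).2 fun x hx =>
      ((hfin x (hT.prop.1 hx)).lt_aleph0).trans_le hreg.aleph0_le
  have := (mk_le_mk_of_subset hcover).trans_lt
    ((mk_union_le _ _).trans_lt (add_lt_of_lt hreg.aleph0_le hlt hU))
  exact this.ne hS

theorem finite_setOf_apply_eq {S : Set X} {G : Set (X → X)} (hG : G.Finite)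
    (hinj : ∀ g ∈ G, InjOn g S) (b : X) : {x ∈ S | ∃ g ∈ G, g x = b}.Finite := by
  refine (hG.biUnion (t := fun g => {x ∈ S | g x = b}) fun g hg =>
    Set.Subsingleton.finite fun x hx y hy =>
      hinj g hg hx.1 hy.1 (hx.2.trans hy.2.symm)).subset ?_
  rintro x ⟨hx, g, hg, hgx⟩
  exact mem_biUnion hg ⟨hx, hgx⟩

theorem exists_subset_separated (hreg : (#X).IsRegular) (z : X) {S : Set X} (hS : #S = #X)
    {G : Set (X → X)} (hG : G.Finite) (hinj : ∀ g ∈ G, InjOn g S) :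
    ∃ T ⊆ S, #T = #X ∧ (∀ x ∈ T, ∀ g ∈ G, g x ≠ z) ∧
      ∀ x ∈ T, ∀ y ∈ T, x ≠ y → ∀ g ∈ G, ∀ h ∈ G, g x ≠ h y := by
  have hZ := finite_setOf_apply_eq hG hinj z
  set S₀ : Set X := S \ {x ∈ S | ∃ g ∈ G, g x = z}
  have hS₀ : #S₀ = #X := by
    refine (mk_set_le _).antisymm (le_of_not_gt fun hlt => ?_)
    have hsub : S ⊆ S₀ ∪ {x ∈ S | ∃ g ∈ G, g x = z} := by
      rw [sdiff_union_self]
      exact subset_union_left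
    exact ((mk_le_mk_of_subset hsub).trans_lt ((mk_union_le _ _).trans_lt
      (add_lt_of_lt hreg.aleph0_le hlt (hZ.lt_aleph0.trans_le hreg.aleph0_le)))).ne hS
  obtain ⟨T, hTS, hT, hp⟩ := exists_subset_pairwise_not hreg
    (fun x y => ∃ g ∈ G, ∃ h ∈ G, g x = h y)
    (fun x y ⟨g, hg, h, hh, e⟩ => ⟨h, hh, g, hg, e.symm⟩) hS₀ (fun x _ => by
      refine (hG.biUnion (t := fun g => {y ∈ S | ∃ h ∈ G, h y = g x}) fun g _ =>
        finite_setOf_apply_eq hG hinj (g x)).subset ?_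
      rintro y ⟨hy, g, hg, h, hh, e⟩
      exact mem_biUnion hg ⟨hy.1, h, hh, e.symm⟩)
  refine ⟨T, hTS.trans sdiff_subset, hT, fun x hx g hg e => ?_, fun x hx y hy hxy g hg h hh e => ?_⟩
  · exact (hTS hx).2 ⟨(hTS hx).1, g, hg, e⟩
  · exact hp hx hy hxy ⟨g, hg, h, hh, e⟩

theorem essentiallyUnary_fst (c : X → X → M) (z : X) (c₀ : M) :
    EssentiallyUnary c z c₀ fun α _ => α := fun S hS =>
  ⟨S, Subset.rfl, hS, ∅, finite_empty, by simp, id, Or.inl fun _ _ _ _ _ => rfl⟩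

theorem essentiallyUnary_snd (c : X → X → M) (z : X) (c₀ : M) :
    EssentiallyUnary c z c₀ fun _ β => β := fun S hS =>
  ⟨S, Subset.rfl, hS, ∅, finite_empty, by simp, id, Or.inr fun _ _ _ _ _ => rfl⟩

theorem EssentiallyUnary.comp_left {c : X → X → M} {z : X} {c₀ : M} {t : X → X → X}
    (ht : EssentiallyUnary c z c₀ t) (f : X → X) :
    EssentiallyUnary c z c₀ fun α β => f (t α β) := fun S hS => by
  obtain ⟨S', hS', hcard, G, hG, hinj, w, h⟩ := ht S hS
  exact ⟨S', hS', hcard, G, hG, hinj, f ∘ w,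
    h.imp (fun h α hα β hβ hs => congrArg f (h α hα β hβ hs))
      (fun h α hα β hβ hs => congrArg f (h α hα β hβ hs))⟩

/-- A binary operation taking the value `z` on all pairs that are off the diagonal, avoid `z` and
have colour `c₀` is unary at separated pairs when its arguments are unary functions of different
variables. -/
theorem exists_unary_of_apply_unary (hreg : (#X).IsRegular) {c : X → X → M} {z : X}
    {c₀ : M} {F : X → X → X}
    (hF : ∀ x y, x ≠ y → x ≠ z → y ≠ z → c x y = c₀ → F x y = z) (w₁ w₂ : X → X)
    {S : Set X} (hS : #S = #X) :
    ∃ S' ⊆ S, #S' = #X ∧ ∃ G : Set (X → X), G.Finite ∧ (∀ g ∈ G, InjOn g S') ∧ ∃ w : X → X,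
      (∀ α ∈ S', ∀ β ∈ S', SeparatedPair c z c₀ G α β → F (w₁ α) (w₂ β) = w α) ∨
      (∀ α ∈ S', ∀ β ∈ S', SeparatedPair c z c₀ G α β → F (w₁ α) (w₂ β) = w β) := by
  obtain ⟨S₁, hS₁, hcard₁, h₁ | ⟨d, hd⟩⟩ := exists_subset_injOn_or_const hreg w₁ hS
  · obtain ⟨S₂, hS₂, hcard₂, h₂ | ⟨d, hd⟩⟩ := exists_subset_injOn_or_const hreg w₂ hcard₁
    · refine ⟨S₂, hS₂.trans hS₁, hcard₂, {w₁, w₂}, by simp, ?_, fun _ => z, Or.inl ?_⟩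
      · rintro g (rfl | rfl)
        exacts [h₁.mono hS₂, h₂]
      · intro α _ β _ hs
        obtain ⟨e₁, e₂, e₃, e₄⟩ := hs w₁ (by simp) w₂ (by simp)
        exact hF _ _ e₁ e₂ e₃ e₄
    · exact ⟨S₂, hS₂.trans hS₁, hcard₂, ∅, finite_empty, by simp, fun α => F (w₁ α) d,
        Or.inl fun α _ β hβ _ => by rw [hd β hβ]⟩
  · exact ⟨S₁, hS₁, hcard₁, ∅, finite_empty, by simp, fun β => F d (w₂ β),
      Or.inr fun α hα β _ _ => by rw [hd α hα]⟩

theorem EssentiallyUnary.apply₂ (hreg : (#X).IsRegular) {c : X → X → M}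
    (hc : ∀ x y, c x y = c y x) {z : X} {c₀ : M} {F : X → X → X}
    (hF : ∀ x y, x ≠ y → x ≠ z → y ≠ z → c x y = c₀ → F x y = z) {t₁ t₂ : X → X → X}
    (ht₁ : EssentiallyUnary c z c₀ t₁) (ht₂ : EssentiallyUnary c z c₀ t₂) :
    EssentiallyUnary c z c₀ fun α β => F (t₁ α β) (t₂ α β) := by
  intro S hS
  obtain ⟨S₁, hS₁, hcard₁, G₁, hG₁, hinj₁, w₁, h₁⟩ := ht₁ S hS
  obtain ⟨S₂, hS₂, hcard₂, G₂, hG₂, hinj₂, w₂, h₂⟩ := ht₂ S₁ hcard₁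
  obtain ⟨S₃, hS₃, hcard₃, G₃, hG₃, hinj₃, w₃, h₃⟩ :=
    exists_unary_of_apply_unary hreg hF w₁ w₂ hcard₂
  have hG₁' : G₁ ⊆ G₁ ∪ (G₂ ∪ G₃) := subset_union_left
  have hG₂' : G₂ ⊆ G₁ ∪ (G₂ ∪ G₃) := subset_union_left.trans subset_union_right
  have hG₃' : G₃ ⊆ G₁ ∪ (G₂ ∪ G₃) := subset_union_right.trans subset_union_right
  refine ⟨S₃, hS₃.trans (hS₂.trans hS₁), hcard₃, G₁ ∪ (G₂ ∪ G₃), hG₁.union (hG₂.union hG₃),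
    ?_, ?_⟩
  · rintro g (hg | hg | hg)
    exacts [(hinj₁ g hg).mono (hS₃.trans hS₂), (hinj₂ g hg).mono hS₃, hinj₃ g hg]
  rcases h₁ with h₁ | h₁ <;> rcases h₂ with h₂ | h₂
  · exact ⟨fun α => F (w₁ α) (w₂ α), Or.inl fun α hα β hβ hs => by
      dsimp only
      rw [h₁ α (hS₂ (hS₃ hα)) β (hS₂ (hS₃ hβ)) (hs.mono hG₁'),
        h₂ α (hS₃ hα) β (hS₃ hβ) (hs.mono hG₂')]⟩
  · refine ⟨w₃, h₃.imp (fun h₃ α hα β hβ hs => ?_) (fun h₃ α hα β hβ hs => ?_)⟩ <;> dsimp only <;>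
    rw [h₁ α (hS₂ (hS₃ hα)) β (hS₂ (hS₃ hβ)) (hs.mono hG₁'),
      h₂ α (hS₃ hα) β (hS₃ hβ) (hs.mono hG₂'), h₃ α hα β hβ (hs.mono hG₃')]
  · refine ⟨w₃, h₃.symm.imp (fun h₃ α hα β hβ hs => ?_) (fun h₃ α hα β hβ hs => ?_)⟩ <;> dsimp only <;>
    rw [h₁ α (hS₂ (hS₃ hα)) β (hS₂ (hS₃ hβ)) (hs.mono hG₁'),
      h₂ α (hS₃ hα) β (hS₃ hβ) (hs.mono hG₂'), h₃ β hβ α hα ((hs.mono hG₃').symm hc)]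
  · exact ⟨fun β => F (w₁ β) (w₂ β), Or.inr fun α hα β hβ hs => by
      dsimp only
      rw [h₁ α (hS₂ (hS₃ hα)) β (hS₂ (hS₃ hβ)) (hs.mono hG₁'),
        h₂ α (hS₃ hα) β (hS₃ hβ) (hs.mono hG₂')]⟩

/-- The operations that preserve essentially unary functions. -/
def essentiallyUnaryClone (c : X → X → M) (z : X) (c₀ : M) : Set (Operation X) :=
  {op | ∀ t : Fin (op.1 + 1) → X → X → X, (∀ i, EssentiallyUnary c z c₀ (t i)) →
    EssentiallyUnary c z c₀ fun α β => op.2 fun i => t i α β}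

theorem isClone_essentiallyUnaryClone (c : X → X → M) (z : X) (c₀ : M) :
    IsClone (essentiallyUnaryClone c z c₀) :=
  ⟨fun _ k _ ht => ht k, fun _ _ _ _ hg hf t ht => hg _ fun i => hf i t ht⟩

theorem PrColoring.not_essentiallyUnary [LinearOrder X] (hreg : (#X).IsRegular)
    {c : X → X → M} (hc : PrColoring c) (z : X) (c₀ : M) {pr F : X → X → X}
    (hpr : IsPairing pr)
    (hF : ∀ x y, x ≠ y → x ≠ z → y ≠ z → c x y = c₀ → F x y = pr x y) :
    ¬ EssentiallyUnary c z c₀ F := by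
  classical
  intro h
  obtain ⟨S, -, hS, G, hG, hinj, w, hw⟩ := h univ mk_univ
  have hG' : (insert id G).Finite := hG.insert id
  obtain ⟨T, hTS, hT, hTz, hTd⟩ := exists_subset_separated hreg z hS hG' (by
    rintro g (rfl | hg)
    exacts [injOn_id S, hinj g hg])
  have hcard : #(X ⊕ X) = #T := by
    rw [mk_sum, lift_id, add_eq_self hreg.aleph0_le, hT]
  obtain ⟨e⟩ := Cardinal.eq.1 hcard
  let a : X → Finset X := fun i =>
    hG'.toFinset.image (fun g => g (e (Sum.inl i))) ∪
      hG'.toFinset.image (fun g => g (e (Sum.inr i)))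
  have hmem : ∀ i, ∀ s ∈ ({Sum.inl i, Sum.inr i} : Set (X ⊕ X)), ∀ g ∈ insert id G,
      g (e s) ∈ a i := by
    rintro i s (rfl | rfl) g hg
    · exact Finset.mem_union_left _ (Finset.mem_image.2 ⟨g, hG'.mem_toFinset.2 hg, rfl⟩)
    · exact Finset.mem_union_right _ (Finset.mem_image.2 ⟨g, hG'.mem_toFinset.2 hg, rfl⟩)
  have hmem' : ∀ i, ∀ x ∈ a i, ∃ s ∈ ({Sum.inl i, Sum.inr i} : Set (X ⊕ X)),
      ∃ g ∈ insert id G, g (e s) = x := by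
    intro i x hx
    rcases Finset.mem_union.1 hx with hx | hx <;> obtain ⟨g, hg, rfl⟩ := Finset.mem_image.1 hx
    · exact ⟨_, Or.inl rfl, g, hG'.mem_toFinset.1 hg, rfl⟩
    · exact ⟨_, Or.inr rfl, g, hG'.mem_toFinset.1 hg, rfl⟩
  have hsep : ∀ s s', s ≠ s' → ∀ g ∈ insert id G, ∀ g' ∈ insert id G, g (e s) ≠ g' (e s') :=
    fun s s' hs => hTd _ (e s).2 _ (e s').2 fun he => hs (e.injective (Subtype.ext he))
  have hdisj : ∀ i j : X, i ≠ j → ∀ s ∈ ({Sum.inl i, Sum.inr i} : Set (X ⊕ X)),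
      ∀ s' ∈ ({Sum.inl j, Sum.inr j} : Set (X ⊕ X)), s ≠ s' := by
    rintro i j hij s (rfl | rfl) s' (rfl | rfl) <;> simp [hij]
  obtain ⟨i, j, hij, hcol⟩ := hc.2 a (fun i j hij => Finset.disjoint_left.2 fun x hx hx' => by
    obtain ⟨s, hs, g, hg, rfl⟩ := hmem' i x hx
    obtain ⟨s', hs', g', hg', he⟩ := hmem' j _ hx'
    exact hsep s s' (hdisj i j hij s hs s' hs') g hg g' hg' he.symm) c₀
  have hpair : ∀ s ∈ ({Sum.inl i, Sum.inr i} : Set (X ⊕ X)),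
      ∀ s' ∈ ({Sum.inl j, Sum.inr j} : Set (X ⊕ X)),
      SeparatedPair c z c₀ (insert id G) (e s) (e s') := fun s hs s' hs' g hg g' hg' =>
    ⟨hsep s s' (hdisj i j hij.ne s hs s' hs') g hg g' hg', hTz _ (e s).2 g hg,
      hTz _ (e s').2 g' hg', hcol _ (hmem i s hs g hg) _ (hmem j s' hs' g' hg')⟩
  have hid : id ∈ insert id G := mem_insert id G
  have hval : ∀ s ∈ ({Sum.inl i, Sum.inr i} : Set (X ⊕ X)),
      ∀ s' ∈ ({Sum.inl j, Sum.inr j} : Set (X ⊕ X)),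
      (e s : X) ≠ e s' ∧ F (e s) (e s') = pr (e s) (e s') := fun s hs s' hs' =>
    let ⟨h₁, h₂, h₃, h₄⟩ := hpair s hs s' hs' id hid id hid
    ⟨h₁, hF _ _ h₁ h₂ h₃ h₄⟩
  have hli : ∀ i : X, Sum.inl i ∈ ({Sum.inl i, Sum.inr i} : Set (X ⊕ X)) := fun i => Or.inl rfl
  have hri : ∀ i : X, Sum.inr i ∈ ({Sum.inl i, Sum.inr i} : Set (X ⊕ X)) := fun i => Or.inr rfl
  have hmono := subset_insert id G
  have hne : ∀ i, (e (Sum.inl i) : X) ≠ e (Sum.inr i) := fun i h =>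
    Sum.inl_ne_inr (e.injective (Subtype.ext h))
  rcases hw with hw | hw
  · have h₁ := hw _ (hTS (e _).2) _ (hTS (e _).2) ((hpair _ (hli i) _ (hli j)).mono hmono)
    have h₂ := hw _ (hTS (e _).2) _ (hTS (e _).2) ((hpair _ (hli i) _ (hri j)).mono hmono)
    obtain ⟨d₁, v₁⟩ := hval _ (hli i) _ (hli j)
    obtain ⟨d₂, v₂⟩ := hval _ (hli i) _ (hri j)
    exact hne j (hpr d₁ d₂ (v₁.symm.trans (h₁.trans (h₂.symm.trans v₂)))).2
  · have h₁ := hw _ (hTS (e _).2) _ (hTS (e _).2) ((hpair _ (hli i) _ (hli j)).mono hmono)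
    have h₂ := hw _ (hTS (e _).2) _ (hTS (e _).2) ((hpair _ (hri i) _ (hli j)).mono hmono)
    obtain ⟨d₁, v₁⟩ := hval _ (hli i) _ (hli j)
    obtain ⟨d₂, v₂⟩ := hval _ (hri i) _ (hli j)
    exact hne i (hpr d₁ d₂ (v₁.symm.trans (h₁.trans (h₂.symm.trans v₂)))).1

end SeparatedPairs

theorem stmt14 {X M : Type u} [LinearOrder X] [WellFoundedLT X]
    (hreg : (#X).IsRegular)
    (hsmall : ∀ x : X, #{y : X | y < x} < #X)
    (c : X → X → M) (hc : PrColoring c)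
    (pr : X → X → X) (hpr : IsPairing pr)
    (z : X) (hz : ∀ x : X, z ≤ x)
    (hzran : z ∉ Set.range fun p : X × X => pr p.1 p.2)
    (k : ℕ) (A : Set M) (B : Fin k → Set M)
    (hA : ¬ A ⊆ ⋃ i, B i) :
    binOp (FA c pr z A) ∉
      cl {op : Operation X | ∃ i : Fin k, op = binOp (FA c pr z (B i))} := by
  obtain ⟨c₀, hc₀A, hc₀B⟩ := not_subset.1 hA
  intro hmem
  have hclone := hmem (essentiallyUnaryClone c z c₀)
    ⟨isClone_essentiallyUnaryClone c z c₀, by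
      rintro _ ⟨i, rfl⟩ t ht
      refine EssentiallyUnary.apply₂ (F := FA c pr z (B i)) hreg hc.1 (fun x y hxy hx hy hcol => ?_)
        (ht 0) (ht 1)
      have hni : c₀ ∉ B i := fun h => hc₀B (mem_iUnion.2 ⟨i, h⟩)
      simp [FA, hx, hy, hxy, hcol, hni], fun f t ht => (ht 0).comp_left f⟩
  refine hc.not_essentiallyUnary hreg z c₀ hpr (F := FA c pr z A) ?_
    (hclone ![fun α _ => α, fun _ β => β] ?_)
  · intro x y hxy hx hy hcol
    simp [FA, hx, hy, hxy, hcol, hc₀A]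
  · intro i
    match i with
    | 0 => exact essentiallyUnary_fst c z c₀
    | 1 => exact essentiallyUnary_snd c z c₀
end
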